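/- (Evolution p-Laplacian, Euclidean case.) Let N ≥ 1 and p > 1, and take m = 1 and f ≡ 1 in the setting. Let a : ℝ^N → ℝ be locally Lipschitz, bounded, with a > 0 a.e., and V ≡ 1. If max(1, p−1) < q ≤ p/N + p−1, then every global nonnegative weak solution of ∂_t u ≥ (1/a) div(a |∇u|^{p−2} ∇u) + u^q (which for a ≡ 1 is the weak form of ∂_t u ≥ Δ_p u + u^q) on S = ℝ^N × (0,∞) is zero a.e. In particular such q exist only when p > 2N/(N+1). -/

import Mathlib

open MeasureTheory Real Set Metric
open scoped ENNReal RealInnerProductSpace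

noncomputable section

/-- Euclidean space `ℝ^N`. -/
abbrev Euc (N : ℕ) : Type := EuclideanSpace ℝ (Fin N)

/-- The parabolic slab `S = ℝ^N × (0,∞)`. -/
def Sset (N : ℕ) : Set (Euc N × ℝ) := {z : Euc N × ℝ | 0 < z.2}

/-- The weighted measure `μ_a = a(x) dx` on `ℝ^N`. -/
def muA {N : ℕ} (a : Euc N → ℝ) : Measure (Euc N) :=
  (volume : Measure (Euc N)).withDensity (fun x => ENNReal.ofReal (a x))

/-- The measure `dμ_a dt` on `ℝ^N × (0,∞)`. -/
def muS {N : ℕ} (a : Euc N → ℝ) : Measure (Euc N × ℝ) :=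
  (muA a).prod ((volume : Measure ℝ).restrict (Set.Ioi (0 : ℝ)))

/-- The continuous linear functional `(w, τ) ↦ ⟪v, w⟫ + c·τ` on `ℝ^N × ℝ`,
encoding a space-time differential with spatial gradient `v` and time derivative `c`. -/
def pairCLM {N : ℕ} (v : Euc N) (c : ℝ) : (Euc N × ℝ) →L[ℝ] ℝ :=
  ((innerSL ℝ v).comp (ContinuousLinearMap.fst ℝ (Euc N) ℝ)) +
    c • (ContinuousLinearMap.snd ℝ (Euc N) ℝ)

/-- `u` is a global nonnegative weak solution of
`∂ₜ u ≥ (1/a) div(a u^{m-1} |∇u|^{p-2} f(|∇u|) ∇u) + V u^q` on `S = ℝ^N × (0,∞)`,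
where `gu`, `ut` are a.e. representatives of the spatial gradient and the time
derivative of `u`. -/
structure IsWeakSol (N : ℕ) (p m q : ℝ) (V : Euc N × ℝ → ℝ) (f : ℝ → ℝ)
    (a : Euc N → ℝ) (u : Euc N × ℝ → ℝ) (gu : Euc N × ℝ → Euc N)
    (ut : Euc N × ℝ → ℝ) : Prop where
  nonneg : ∀ z ∈ Sset N, 0 ≤ u z
  locLip : LocallyLipschitzOn (Sset N) u
  deriv_ae : ∀ᵐ z ∂ ((volume : Measure (Euc N × ℝ)).restrict (Sset N)),
      DifferentiableAt ℝ u z → HasFDerivAt u (pairCLM (gu z) (ut z)) z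
  int_uqV : LocallyIntegrableOn (fun z => u z ^ q * V z) (Sset N) (muS a)
  int_upm : LocallyIntegrableOn (fun z => u z ^ (p + m - 1)) (Sset N) (muS a)
  int_gu : LocallyIntegrableOn (fun z => ‖gu z‖ ^ p * u z ^ (m - 1)) (Sset N) (muS a)
  int_ut : LocallyIntegrableOn (fun z => u z * ut z) (Sset N) (muS a)
  weak_ineq : ∀ (ψ : Euc N × ℝ → ℝ) (gψ : Euc N × ℝ → Euc N) (tψ : Euc N × ℝ → ℝ),
      (∀ z, 0 ≤ ψ z) → LocallyLipschitz ψ → HasCompactSupport ψ →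
      tsupport ψ ⊆ Sset N →
      (∀ᵐ z ∂ (volume : Measure (Euc N × ℝ)),
        DifferentiableAt ℝ ψ z → HasFDerivAt ψ (pairCLM (gψ z) (tψ z)) z) →
      ∫ z, ψ z * u z ^ q * V z ∂ muS a ≤
        (∫ z, ⟪gψ z, gu z⟫ * u z ^ (m - 1) * ‖gu z‖ ^ (p - 2) * f ‖gu z‖ ∂ muS a)
          - ∫ z, tψ z * u z ∂ muS a

/-- The region `E_R = {(x,t) ∈ S : |x|^θ2 + t^θ1 ≤ R^θ2}`. -/
def ESet (N : ℕ) (θ1 θ2 R : ℝ) : Set (Euc N × ℝ) :=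
  {z ∈ Sset N | ‖z.1‖ ^ θ2 + z.2 ^ θ1 ≤ R ^ θ2}

/-- The time cutoff `χ_β`. -/
def chi (β t : ℝ) : ℝ := min 1 (max 0 (t / β - 1))

/-! ### Locally Lipschitz functions -/

/-- Pointwise composition of locally Lipschitz maps. -/
lemma exists_lipschitzOnWith_comp {X Y Z : Type*} [PseudoEMetricSpace X] [PseudoEMetricSpace Y]
    [PseudoEMetricSpace Z] {f : X → Y} {g : Y → Z} {x : X}
    (hf : ∃ K, ∃ t ∈ nhds x, LipschitzOnWith K f t)
    (hg : ∃ K, ∃ t ∈ nhds (f x), LipschitzOnWith K g t) :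
    ∃ K, ∃ t ∈ nhds x, LipschitzOnWith K (fun y => g (f y)) t := by
  obtain ⟨K, s, hs, hfs⟩ := hf
  obtain ⟨L, t, ht, hgt⟩ := hg
  have hc : ContinuousAt f x := hfs.continuousOn.continuousAt hs
  exact ⟨L * K, s ∩ f ⁻¹' t, Filter.inter_mem hs (hc ht),
    hgt.comp (hfs.mono inter_subset_left) fun y hy => hy.2⟩

lemma exists_lipschitzOnWith_prodMk {X Y Z : Type*} [PseudoEMetricSpace X] [PseudoEMetricSpace Y]
    [PseudoEMetricSpace Z] {f : X → Y} {g : X → Z} {x : X}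
    (hf : ∃ K, ∃ t ∈ nhds x, LipschitzOnWith K f t)
    (hg : ∃ K, ∃ t ∈ nhds x, LipschitzOnWith K g t) :
    ∃ K, ∃ t ∈ nhds x, LipschitzOnWith K (fun y => (f y, g y)) t := by
  obtain ⟨K, s, hs, hfs⟩ := hf
  obtain ⟨L, t, ht, hgt⟩ := hg
  refine ⟨max K L, s ∩ t, Filter.inter_mem hs ht, ?_⟩
  exact (hfs.mono inter_subset_left).prodMk (hgt.mono inter_subset_right)

lemma exists_lipschitzOnWith_of_eventually_zero {X : Type*} [PseudoEMetricSpace X]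
    {f : X → ℝ} {x : X} (hf : ∀ᶠ y in nhds x, f y = 0) :
    ∃ K, ∃ t ∈ nhds x, LipschitzOnWith K f t :=
  ⟨0, {y | f y = 0}, hf, fun y hy z hz => by rw [hy, hz]; simp⟩

/-- A locally Lipschitz function with compact support is globally Lipschitz. -/
lemma LocallyLipschitz.exists_lipschitzWith_of_hasCompactSupport {E : Type*}
    [NormedAddCommGroup E] [ProperSpace E] {f : E → ℝ} (hf : LocallyLipschitz f)
    (hc : HasCompactSupport f) : ∃ K, LipschitzWith K f := by
  obtain ⟨R, hR⟩ := hc.isCompact.isBounded.subset_closedBall (0 : E)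
  obtain ⟨K, hK⟩ := (hf.locallyLipschitzOn (s := closedBall 0 (R + 1))).exists_lipschitzOnWith_of_compact
    (isCompact_closedBall _ _)
  obtain ⟨M, hM⟩ := hf.continuous.bounded_above_of_compact_support hc
  have hM0 : 0 ≤ M := (norm_nonneg _).trans (hM 0)
  have hz : ∀ x, R < ‖x‖ → f x = 0 := fun x hx => by
    refine image_eq_zero_of_notMem_tsupport fun h => ?_
    have := hR h
    simp only [mem_closedBall, dist_zero_right] at this
    linarith
  have key : ∀ x y, ‖x‖ ≤ R + 1 → R + 1 < ‖y‖ → dist (f x) (f y) ≤ (K + M) * dist x y := by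
    intro x y hx hy
    rw [hz y (by linarith)]
    by_cases hxR : ‖x‖ ≤ R
    · have h1 : 1 ≤ dist x y := by
        rw [dist_comm, dist_eq_norm]
        have := norm_sub_norm_le y x
        linarith
      have h2 : dist (f x) 0 ≤ M := by simpa using hM x
      have h3 : (0 : ℝ) ≤ K := K.2
      nlinarith
    · rw [hz x (not_le.1 hxR)]
      simp only [dist_self]
      positivity
  refine ⟨K + ⟨M, hM0⟩, LipschitzWith.of_dist_le_mul fun x y => ?_⟩
  change dist (f x) (f y) ≤ (K + M) * dist x y
  rcases le_or_gt ‖x‖ (R + 1) with hx | hx <;> rcases le_or_gt ‖y‖ (R + 1) with hy | hy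
  · refine (hK.dist_le_mul x (by simpa using hx) y (by simpa using hy)).trans ?_
    gcongr
    linarith
  · exact key x y hx hy
  · rw [dist_comm, dist_comm x y]
    exact key y x hy hx
  · rw [hz x (by linarith), hz y (by linarith)]
    simp only [dist_self]
    positivity

lemma ContDiffAt.exists_lipschitzOnWith_comp {X F : Type*} [PseudoEMetricSpace X]
    [NormedAddCommGroup F] [NormedSpace ℝ F] {g : F → ℝ} {f : X → F} {x : X}
    (hg : ContDiffAt ℝ 1 g (f x)) (hf : ∃ K, ∃ t ∈ nhds x, LipschitzOnWith K f t) :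
    ∃ K, ∃ t ∈ nhds x, LipschitzOnWith K (fun y => g (f y)) t :=
  _root_.exists_lipschitzOnWith_comp hf hg.exists_lipschitzOnWith

/-- Rademacher's theorem for functions that are locally Lipschitz on an open set. -/
lemma LocallyLipschitzOn.ae_differentiableAt {E : Type*} [NormedAddCommGroup E] [NormedSpace ℝ E]
    [FiniteDimensional ℝ E] [MeasurableSpace E] [BorelSpace E] (μ : Measure E)
    [μ.IsAddHaarMeasure] {s : Set E} (hs : IsOpen s) {f : E → ℝ} (hf : LocallyLipschitzOn s f) :
    ∀ᵐ x ∂(μ.restrict s), DifferentiableAt ℝ f x := by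
  rw [ae_restrict_iff' hs.measurableSet, ae_iff]
  refine measure_null_of_locally_null _ fun x hx => ?_
  have hxs : x ∈ s := by
    by_contra h
    exact hx fun h' => absurd h' h
  obtain ⟨K, t, ht, hft⟩ := hf hxs
  rw [hs.nhdsWithin_eq hxs] at ht
  obtain ⟨v, hvt, hv, hxv⟩ := _root_.mem_nhds_iff.1 ht
  refine ⟨{y | ¬(y ∈ s → DifferentiableAt ℝ f y)} ∩ v, inter_mem_nhdsWithin _ (hv.mem_nhds hxv), ?_⟩
  have := (hft.mono hvt).ae_differentiableWithinAt_of_mem (μ := μ)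
  refine measure_mono_null ?_ (ae_iff.1 this)
  rintro y ⟨hy, hyv⟩ h
  exact hy fun _ => (h hyv).differentiableAt (hv.mem_nhds hyv)

/-- The integral of a directional derivative of a compactly supported Lipschitz function
vanishes. -/
lemma LipschitzWith.integral_lineDeriv_eq_zero {E : Type*} [NormedAddCommGroup E] [NormedSpace ℝ E]
    [FiniteDimensional ℝ E] [MeasurableSpace E] [BorelSpace E] (μ : Measure E)
    [μ.IsAddHaarMeasure] {f : E → ℝ} {K : NNReal} (hf : LipschitzWith K f)
    (hc : HasCompactSupport f) (v : E) :
    Integrable (fun x => lineDeriv ℝ f x v) μ ∧ ∫ x, lineDeriv ℝ f x v ∂μ = 0 := by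
  constructor
  · have h0 : Function.support (fun x => lineDeriv ℝ f x v) ⊆ tsupport f := by
      intro x hx
      by_contra h
      refine hx ?_
      have : f =ᶠ[nhds x] fun _ => (0 : ℝ) := notMem_tsupport_iff_eventuallyEq.1 h
      change lineDeriv ℝ f x v = 0
      rw [this.lineDeriv_eq]
      simp [lineDeriv]
    refine (integrableOn_iff_integrable_of_support_subset h0).1 ?_
    exact (hf.locallyIntegrable_lineDeriv v).integrableOn_isCompact hc
  · have := integral_lineDeriv_mul_eq (μ := μ) (LipschitzWith.const (1 : ℝ)) hf hc (-v)
    simpa [lineDeriv] using this.symm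

/-! ### The weighted measure -/

instance isAddHaarMeasure_volume_prod (N : ℕ) :
    (volume : Measure (Euc N × ℝ)).IsAddHaarMeasure :=
  inferInstanceAs ((volume : Measure (Euc N)).prod (volume : Measure ℝ)).IsAddHaarMeasure

lemma isOpen_Sset (N : ℕ) : IsOpen (Sset N) := isOpen_lt continuous_const continuous_snd

lemma muS_eq_withDensity {N : ℕ} {a : Euc N → ℝ} (ha : Continuous a) :
    muS a = ((volume : Measure (Euc N × ℝ)).restrict (Sset N)).withDensity
      (fun z => ENNReal.ofReal (a z.1)) := by
  have hS : Sset N = Set.univ ×ˢ Set.Ioi (0 : ℝ) := by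
    ext z
    simp [Sset]
  rw [muS, muA, prod_withDensity_left (by fun_prop), hS, Measure.volume_eq_prod,
    ← Measure.prod_restrict, Measure.restrict_univ]

lemma isLocallyFiniteMeasure_muS {N : ℕ} {a : Euc N → ℝ} (ha : Continuous a) :
    IsLocallyFiniteMeasure (muS a) := by
  rw [muS_eq_withDensity ha]
  exact IsLocallyFiniteMeasure.withDensity_ofReal (f := fun z : Euc N × ℝ => a z.1) (by fun_prop)

lemma ae_muS_of_ae_restrict {N : ℕ} {a : Euc N → ℝ} (ha : Continuous a) {P : Euc N × ℝ → Prop}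
    (h : ∀ᵐ z ∂((volume : Measure (Euc N × ℝ)).restrict (Sset N)), P z) :
    ∀ᵐ z ∂(muS a), P z := by
  rw [muS_eq_withDensity ha]
  exact (withDensity_absolutelyContinuous _ _).ae_le h

lemma ae_muS_mem_Sset {N : ℕ} {a : Euc N → ℝ} (ha : Continuous a) :
    ∀ᵐ z ∂(muS a), z ∈ Sset N :=
  ae_muS_of_ae_restrict ha (ae_restrict_mem (isOpen_Sset N).measurableSet)

lemma ae_restrict_of_ae_muS {N : ℕ} {a : Euc N → ℝ} (ha : Continuous a)
    (haPos : ∀ᵐ x ∂(volume : Measure (Euc N)), 0 < a x) {P : Euc N × ℝ → Prop}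
    (h : ∀ᵐ z ∂(muS a), P z) :
    ∀ᵐ z ∂((volume : Measure (Euc N × ℝ)).restrict (Sset N)), P z := by
  rw [muS_eq_withDensity ha] at h
  have hpos : ∀ᵐ z ∂(volume : Measure (Euc N × ℝ)), 0 < a z.1 :=
    Measure.quasiMeasurePreserving_fst.ae haPos
  refine (withDensity_absolutelyContinuous' (by fun_prop) ?_).ae_le h
  filter_upwards [ae_restrict_of_ae hpos] with z hz
  simpa using hz

/-- A function continuous on the slab and vanishing off a compact subset of it is integrable. -/
lemma integrable_muS_of_continuousOn {N : ℕ} {a : Euc N → ℝ} (ha : Continuous a)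
    {K : Set (Euc N × ℝ)} (hK : IsCompact K) (hKS : K ⊆ Sset N) {f : Euc N × ℝ → ℝ}
    (hf : ContinuousOn f (Sset N)) (h0 : ∀ z, z ∉ K → f z = 0) : Integrable f (muS a) := by
  have := isLocallyFiniteMeasure_muS ha
  refine (integrableOn_iff_integrable_of_support_subset (s := K) fun z hz => ?_).1
    ((hf.mono hKS).integrableOn_compact hK)
  by_contra h
  exact hz (h0 z h)

/-! ### Test functions built from the solution -/

lemma hasFDerivAt_pow_mul_comp {N : ℕ} {φ u : Euc N × ℝ → ℝ} {z : Euc N × ℝ} {gφ gu : Euc N}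
    {tφ ut : ℝ} (hφ : HasFDerivAt φ (pairCLM gφ tφ) z) (hu : HasFDerivAt u (pairCLM gu ut) z)
    {k : ℝ → ℝ} {k' : ℝ} (hk : HasDerivAt k k' (u z)) (n : ℕ) :
    HasFDerivAt (fun y => φ y ^ n * k (u y))
      (pairCLM ((n * φ z ^ (n - 1) * k (u z)) • gφ + (φ z ^ n * k') • gu)
        (n * φ z ^ (n - 1) * tφ * k (u z) + φ z ^ n * k' * ut)) z := by
  refine ((hφ.pow n).mul (hk.comp_hasFDerivAt z hu)).congr_fderiv ?_
  ext w
  · simp [pairCLM]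
    ring
  · simp [pairCLM]
    ring

lemma locallyLipschitz_mul_pow_mul_comp {N : ℕ} {b φ u : Euc N × ℝ → ℝ}
    (hb : LocallyLipschitz b) (hφ : ContDiff ℝ 1 φ) (hφS : tsupport φ ⊆ Sset N)
    (hu : LocallyLipschitzOn (Sset N) u) (hu0 : ∀ z ∈ Sset N, 0 ≤ u z) {k : ℝ → ℝ}
    (hk : ∀ v, 0 ≤ v → ContDiffAt ℝ 1 k v) {n : ℕ} (hn : n ≠ 0) :
    LocallyLipschitz (fun z => b z * (φ z ^ n * k (u z))) := by
  intro z
  by_cases hz : z ∈ Sset N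
  · have huz : ∃ K, ∃ t ∈ nhds z, LipschitzOnWith K u t := by
      obtain ⟨K, t, ht, h⟩ := hu hz
      rw [(isOpen_Sset N).nhdsWithin_eq hz] at ht
      exact ⟨K, t, ht, h⟩
    have hpair := exists_lipschitzOnWith_prodMk (hb z)
      (exists_lipschitzOnWith_prodMk (hφ.contDiffAt (x := z)).exists_lipschitzOnWith huz)
    have hg : ContDiffAt ℝ 1 (fun y : ℝ × ℝ × ℝ => y.1 * (y.2.1 ^ n * k y.2.2))
        (b z, φ z, u z) := by
      refine contDiffAt_fst.mul ((contDiffAt_snd.fst.pow n).mul ?_)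
      exact ContDiffAt.comp (b z, φ z, u z) (g := k) (hk _ (hu0 z hz)) contDiffAt_snd.snd
    exact hg.exists_lipschitzOnWith_comp (f := fun y => (b y, φ y, u y)) hpair
  · refine exists_lipschitzOnWith_of_eventually_zero ?_
    filter_upwards [notMem_tsupport_iff_eventuallyEq.1 fun h => hz (hφS h)] with y hy
    rw [hy]
    simp [hn]

lemma hasCompactSupport_mul_pow_mul {X : Type*} [TopologicalSpace X] {b φ c : X → ℝ}
    (hφ : HasCompactSupport φ) {n : ℕ} (hn : n ≠ 0) :
    HasCompactSupport (fun z => b z * (φ z ^ n * c z)) := by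
  refine hφ.mono fun z hz h => hz ?_
  change b z * (φ z ^ n * c z) = 0
  rw [h]
  simp [hn]

/-- The time derivative of a compactly supported truncation of a function of the solution
integrates to zero. -/
lemma integral_time_deriv_eq_zero {N : ℕ} {a : Euc N → ℝ} (haLip : LocallyLipschitz a)
    (ha0 : ∀ x, 0 ≤ a x) {u : Euc N × ℝ → ℝ} {gu : Euc N × ℝ → Euc N} {ut : Euc N × ℝ → ℝ}
    (hu : LocallyLipschitzOn (Sset N) u) (hu0 : ∀ z ∈ Sset N, 0 ≤ u z)
    (hud : ∀ᵐ z ∂((volume : Measure (Euc N × ℝ)).restrict (Sset N)),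
      HasFDerivAt u (pairCLM (gu z) (ut z)) z)
    {φ : Euc N × ℝ → ℝ} {gφ : Euc N × ℝ → Euc N} {tφ : Euc N × ℝ → ℝ} (hφ : ContDiff ℝ 1 φ)
    (hφc : HasCompactSupport φ) (hφS : tsupport φ ⊆ Sset N)
    (hφd : ∀ z, HasFDerivAt φ (pairCLM (gφ z) (tφ z)) z) {k k' : ℝ → ℝ}
    (hk : ∀ v, 0 ≤ v → ContDiffAt ℝ 1 k v) (hk' : ∀ v, 0 ≤ v → HasDerivAt k (k' v) v)
    {n : ℕ} (hn : n ≠ 0) :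
    Integrable (fun z => n * φ z ^ (n - 1) * tφ z * k (u z) + φ z ^ n * k' (u z) * ut z) (muS a) ∧
      ∫ z, (n * φ z ^ (n - 1) * tφ z * k (u z) + φ z ^ n * k' (u z) * ut z) ∂(muS a) = 0 := by
  set D : Euc N × ℝ → ℝ :=
    fun z => n * φ z ^ (n - 1) * tφ z * k (u z) + φ z ^ n * k' (u z) * ut z with hD
  set W : Euc N × ℝ → ℝ := fun z => a z.1 * (φ z ^ n * k (u z)) with hW
  have haf : LocallyLipschitz (fun z : Euc N × ℝ => a z.1) :=
    fun z => exists_lipschitzOnWith_comp (LipschitzWith.prod_fst.locallyLipschitz z) (haLip z.1)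
  have hWl : LocallyLipschitz W :=
    locallyLipschitz_mul_pow_mul_comp haf hφ hφS hu hu0 hk hn
  have hWc : HasCompactSupport W := hasCompactSupport_mul_pow_mul hφc hn
  obtain ⟨K, hK⟩ := hWl.exists_lipschitzWith_of_hasCompactSupport hWc
  obtain ⟨hWi, hW0⟩ := hK.integral_lineDeriv_eq_zero (volume : Measure (Euc N × ℝ)) hWc (0, 1)
  have hae : ∀ᵐ z ∂((volume : Measure (Euc N × ℝ)).restrict (Sset N)),
      lineDeriv ℝ W z (0, 1) = a z.1 * D z := by
    filter_upwards [hud, ae_restrict_mem (isOpen_Sset N).measurableSet] with z hz hzS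
    have h1 := (hasFDerivAt_pow_mul_comp (hφd z) hz (hk' _ (hu0 z hzS)) n).hasLineDerivAt (0, 1)
    have h2 : HasLineDerivAt ℝ W (a z.1 * D z) z (0, 1) := by
      have h3 := HasDerivAt.const_mul (a z.1) h1
      refine (h3.congr_deriv ?_).congr_of_eventuallyEq (Filter.Eventually.of_forall fun t => ?_)
      · simp [pairCLM, hD]
      · simp [hW]
    exact h2.lineDeriv
  have hout : ∀ z, z ∉ Sset N → lineDeriv ℝ W z (0, 1) = 0 := fun z hz => by
    have : W =ᶠ[nhds z] fun _ => (0 : ℝ) := by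
      filter_upwards [notMem_tsupport_iff_eventuallyEq.1 fun h => hz (hφS h)] with y hy
      simp [hW, hy, hn]
    rw [this.lineDeriv_eq]
    simp [lineDeriv]
  have hm : Measurable fun z : Euc N × ℝ => ENNReal.ofReal (a z.1) := by
    have := haLip.continuous
    fun_prop
  have hreal : ∀ z : Euc N × ℝ, (ENNReal.ofReal (a z.1)).toReal • D z = a z.1 * D z := fun z => by
    rw [ENNReal.toReal_ofReal (ha0 _), smul_eq_mul]
  rw [muS_eq_withDensity haLip.continuous]
  constructor
  · rw [integrable_withDensity_iff_integrable_smul' hm (by simp)]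
    simp only [hreal]
    exact (hWi.restrict (s := Sset N)).congr hae
  · change ∫ z, D z ∂_ = 0
    rw [integral_withDensity_eq_integral_toReal_smul hm (by simp)]
    simp only [hreal]
    rw [← integral_congr_ae hae, setIntegral_eq_integral_of_forall_compl_eq_zero hout, hW0]

lemma integral_le_integral_of_ae_le_of_nonneg {X : Type*} [MeasurableSpace X] {μ : Measure X}
    {f g : X → ℝ} (hg : Integrable g μ) (hg0 : 0 ≤ᵐ[μ] g) (hfg : f ≤ᵐ[μ] g) :
    ∫ x, f x ∂μ ≤ ∫ x, g x ∂μ := by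
  by_cases hf : Integrable f μ
  · exact integral_mono_ae hf hg hfg
  · rw [integral_undef hf]
    exact integral_nonneg_of_ae hg0

lemma integral_add_of_integral_right_eq_zero {X : Type*} [MeasurableSpace X] {μ : Measure X}
    {f g : X → ℝ} (hg : Integrable g μ) (hg0 : ∫ x, g x ∂μ = 0) :
    ∫ x, (f x + g x) ∂μ = ∫ x, f x ∂μ := by
  by_cases hf : Integrable f μ
  · rw [integral_add hf hg, hg0, add_zero]
  · rw [integral_undef hf, integral_undef]
    exact fun h => hf ((integrable_add_iff_integrable_left' hg).1 h)

/-- The flux term tested against the gradient of `φ ^ n * h u`. -/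
lemma inner_mul_rpow_le {N : ℕ} {p : ℝ} (hp : 1 < p) {c d : ℝ} (hc : 0 ≤ c) (g v : Euc N) :
    ⟪c • g + d • v, v⟫ * ‖v‖ ^ (p - 2) ≤ c * ‖g‖ * ‖v‖ ^ (p - 1) + d * ‖v‖ ^ p := by
  rcases eq_or_ne v 0 with rfl | hv
  · simp [Real.zero_rpow (by linarith : p ≠ 0), Real.zero_rpow (by linarith : p - 1 ≠ 0)]
  · have hv' : 0 < ‖v‖ := norm_pos_iff.2 hv
    have e1 : ‖v‖ ^ (p - 1) = ‖v‖ * ‖v‖ ^ (p - 2) := by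
      rw [show p - 1 = 1 + (p - 2) by ring, Real.rpow_add hv', Real.rpow_one]
    have e2 : ‖v‖ ^ p = ‖v‖ * ‖v‖ * ‖v‖ ^ (p - 2) := by
      rw [show p = 1 + 1 + (p - 2) by ring, Real.rpow_add hv', Real.rpow_add hv', Real.rpow_one]
      ring_nf
    have h1 : ⟪g, v⟫ ≤ ‖g‖ * ‖v‖ := real_inner_le_norm g v
    have h2 : 0 ≤ ‖v‖ ^ (p - 2) := by positivity
    rw [inner_add_left, inner_smul_left, inner_smul_left, real_inner_self_eq_norm_mul_norm, e1, e2]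
    simp only [conj_trivial]
    nlinarith [mul_le_mul_of_nonneg_right (mul_le_mul_of_nonneg_left h1 hc) h2]

/-- Testing the differential inequality with `φ ^ n * h u`, after integrating the time
derivative by parts. -/
theorem IsWeakSol.integral_pow_mul_le {N : ℕ} {p q : ℝ} (hp : 1 < p) (hq : 0 < q)
    {a : Euc N → ℝ} (haLip : LocallyLipschitz a) (ha0 : ∀ x, 0 ≤ a x)
    {u : Euc N × ℝ → ℝ} {gu : Euc N × ℝ → Euc N} {ut : Euc N × ℝ → ℝ}
    (hu : IsWeakSol N p 1 q (fun _ => 1) (fun _ => 1) a u gu ut)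
    {φ : Euc N × ℝ → ℝ} {gφ : Euc N × ℝ → Euc N} {tφ : Euc N × ℝ → ℝ} (hφ : ContDiff ℝ 1 φ)
    (hφ0 : ∀ z, 0 ≤ φ z) (hφc : HasCompactSupport φ) (hφS : tsupport φ ⊆ Sset N)
    (hφd : ∀ z, HasFDerivAt φ (pairCLM (gφ z) (tφ z)) z) {h h' P : ℝ → ℝ}
    (hh : ∀ v, 0 ≤ v → ContDiffAt ℝ 1 h v) (hh' : ∀ v, 0 ≤ v → HasDerivAt h (h' v) v)
    (hP : ∀ v, 0 ≤ v → ContDiffAt ℝ 1 P v) (hP' : ∀ v, 0 ≤ v → HasDerivAt P (v * h' v) v)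
    (h1 : ∀ v, 0 ≤ v → 1 ≤ h v) {n : ℕ} (hn : 2 ≤ n) {B : Euc N × ℝ → ℝ}
    (hB : Integrable B (muS a)) (hB0 : ∀ z ∈ Sset N, 0 ≤ B z)
    (hBx : ∀ z ∈ Sset N, ∀ G : ℝ, 0 ≤ G →
      n * φ z ^ (n - 1) * h (u z) * ‖gφ z‖ * G ^ (p - 1) + φ z ^ n * h' (u z) * G ^ p ≤ B z)
    (hBt : ∀ z ∈ Sset N, -(n * φ z ^ (n - 1) * tφ z * (u z * h (u z) - P (u z))) ≤ B z) :
    ∫ z, φ z ^ n * u z ^ q ∂(muS a) ≤ 2 * ∫ z, B z ∂(muS a) := by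
  have haC := haLip.continuous
  have hn0 : n ≠ 0 := by omega
  have hn1 : n - 1 ≠ 0 := by omega
  have huC : ContinuousOn u (Sset N) := hu.locLip.continuousOn
  have hSae := ae_muS_mem_Sset (N := N) haC
  have hud : ∀ᵐ z ∂((volume : Measure (Euc N × ℝ)).restrict (Sset N)),
      HasFDerivAt u (pairCLM (gu z) (ut z)) z := by
    filter_upwards [hu.deriv_ae, hu.locLip.ae_differentiableAt volume (isOpen_Sset N)]
      with z hz hd using hz hd
  have hφz : ∀ z, z ∉ Sset N → φ z = 0 := fun z hz =>
    image_eq_zero_of_notMem_tsupport fun hh => hz (hφS hh)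
  have hcont : ∀ k : ℝ → ℝ, (∀ v, 0 ≤ v → ContDiffAt ℝ 1 k v) →
      ContinuousOn (fun z => k (u z)) (Sset N) := fun k hk z hz =>
    ContinuousAt.comp_continuousWithinAt (hk _ (hu.nonneg z hz)).continuousAt (huC z hz)
  set ψ : Euc N × ℝ → ℝ := fun z => φ z ^ n * h (u z) with hψ
  have hψ0 : ∀ z, 0 ≤ ψ z := fun z => by
    by_cases hz : z ∈ Sset N
    · exact mul_nonneg (pow_nonneg (hφ0 z) n) (zero_le_one.trans (h1 _ (hu.nonneg z hz)))
    · simp [hψ, hφz z hz, hn0]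
  have hψl : LocallyLipschitz ψ := by
    simpa using locallyLipschitz_mul_pow_mul_comp (LocallyLipschitz.const (1 : ℝ)) hφ hφS
      hu.locLip hu.nonneg hh hn0
  have hψsupp : Function.support ψ ⊆ Function.support φ := fun z hz hz' =>
    hz (by simp [hψ, hz', hn0])
  have hψc : HasCompactSupport ψ := hφc.mono hψsupp
  have hψS : tsupport ψ ⊆ Sset N := (closure_mono hψsupp).trans hφS
  have hψd : ∀ᵐ z ∂(volume : Measure (Euc N × ℝ)), DifferentiableAt ℝ ψ z →
      HasFDerivAt ψ (pairCLM
        ((n * φ z ^ (n - 1) * h (u z)) • gφ z + (φ z ^ n * h' (u z)) • gu z)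
        (n * φ z ^ (n - 1) * tφ z * h (u z) + φ z ^ n * h' (u z) * ut z)) z := by
    rw [ae_restrict_iff' (isOpen_Sset N).measurableSet] at hud
    filter_upwards [hud] with z hz _
    by_cases hzS : z ∈ Sset N
    · exact hasFDerivAt_pow_mul_comp (hφd z) (hz hzS) (hh' _ (hu.nonneg z hzS)) n
    · have h0 : ψ =ᶠ[nhds z] fun _ => (0 : ℝ) :=
        notMem_tsupport_iff_eventuallyEq.1 fun h => hzS (hψS h)
      refine ((hasFDerivAt_const (0 : ℝ) z).congr_of_eventuallyEq h0).congr_fderiv ?_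
      ext w <;> simp [pairCLM, hφz z hzS, hn0, hn1]
  have hweak := hu.weak_ineq ψ _ _ hψ0 hψl hψc hψS hψd
  obtain ⟨hDi, hD0⟩ := integral_time_deriv_eq_zero haLip ha0 hu.locLip hu.nonneg hud hφ hφc hφS hφd
    hP hP' hn0
  have hB0ae : 0 ≤ᵐ[muS a] B := hSae.mono hB0
  have hx : ∫ z, ⟪(n * φ z ^ (n - 1) * h (u z)) • gφ z + (φ z ^ n * h' (u z)) • gu z, gu z⟫
      * u z ^ ((1 : ℝ) - 1) * ‖gu z‖ ^ (p - 2) * 1 ∂(muS a) ≤ ∫ z, B z ∂(muS a) := by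
    refine integral_le_integral_of_ae_le_of_nonneg hB hB0ae ?_
    filter_upwards [hSae] with z hz
    rw [sub_self, Real.rpow_zero, mul_one, mul_one]
    refine (inner_mul_rpow_le hp ?_ _ _).trans (hBx z hz _ (norm_nonneg _))
    have := hφ0 z
    have := h1 _ (hu.nonneg z hz)
    positivity
  have ht : -∫ z, (n * φ z ^ (n - 1) * tφ z * h (u z) + φ z ^ n * h' (u z) * ut z) * u z ∂(muS a)
      ≤ ∫ z, B z ∂(muS a) := by
    rw [← integral_neg, ← integral_add_of_integral_right_eq_zero hDi hD0]
    refine integral_le_integral_of_ae_le_of_nonneg hB hB0ae ?_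
    filter_upwards [hSae] with z hz
    refine le_trans (le_of_eq ?_) (hBt z hz)
    ring
  have hl : ∫ z, φ z ^ n * u z ^ q ∂(muS a) ≤ ∫ z, ψ z * u z ^ q * 1 ∂(muS a) := by
    have hcφ : ContinuousOn (fun z => φ z ^ n) (Sset N) := (hφ.continuous.pow n).continuousOn
    have hcq : ContinuousOn (fun z => u z ^ q) (Sset N) :=
      huC.rpow_const fun z _ => Or.inr hq.le
    refine integral_mono_ae ?_ ?_ ?_
    · refine integrable_muS_of_continuousOn haC hφc hφS (hcφ.mul hcq) fun z hz => ?_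
      simp [image_eq_zero_of_notMem_tsupport hz, hn0]
    · refine integrable_muS_of_continuousOn haC hφc hφS
        (((hcφ.mul (hcont h hh)).mul hcq).mul continuousOn_const) fun z hz => ?_
      simp [hψ, image_eq_zero_of_notMem_tsupport hz, hn0]
    · filter_upwards [hSae] with z hz
      have e1 := h1 _ (hu.nonneg z hz)
      have e2 : 0 ≤ φ z ^ n := pow_nonneg (hφ0 z) n
      have e3 : 0 ≤ u z ^ q := Real.rpow_nonneg (hu.nonneg z hz) q
      simp only [hψ, mul_one]
      gcongr
      exact le_mul_of_one_le_right e2 e1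
  linarith

lemma exists_mul_rpow_le_add {c δ r q : ℝ} (hc : 0 ≤ c) (hδ : 0 < δ) (hr : 0 ≤ r) (hrq : r < q) :
    ∃ C : ℝ, 0 ≤ C ∧ ∀ w : ℝ, 0 ≤ w → c * w ^ r ≤ δ * w ^ q + C := by
  have hqr : 0 < q - r := by linarith
  set W : ℝ := (c / δ) ^ (q - r)⁻¹ with hW
  have hW0 : 0 ≤ W := by positivity
  refine ⟨c * W ^ r, by positivity, fun w hw => ?_⟩
  rcases le_or_gt w W with h | h
  · have : w ^ r ≤ W ^ r := Real.rpow_le_rpow hw h hr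
    have : 0 ≤ δ * w ^ q := by positivity
    nlinarith
  · have hw' : 0 < w := hW0.trans_lt h
    have h1 : c / δ ≤ w ^ (q - r) := by
      have := Real.rpow_le_rpow hW0 h.le hqr.le
      rwa [hW, ← Real.rpow_mul (by positivity), inv_mul_cancel₀ hqr.ne', Real.rpow_one] at this
    have h2 : w ^ q = w ^ (q - r) * w ^ r := by
      rw [← Real.rpow_add hw']
      ring_nf
    have h3 : c ≤ δ * w ^ (q - r) := by
      rw [div_le_iff₀ hδ] at h1
      linarith
    have : c * w ^ r ≤ δ * w ^ (q - r) * w ^ r := by gcongr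
    have : 0 ≤ c * W ^ r := by positivity
    rw [h2]
    linarith

lemma exists_mul_rpow_le_add_mul {c ε r q : ℝ} (hc : 0 ≤ c) (hε : 0 < ε) (hr : 0 < r)
    (hrq : r ≤ q) :
    ∃ M : ℝ, 0 ≤ M ∧ ∀ w : ℝ, 0 ≤ w → c * w ^ r ≤ ε + M * w ^ q := by
  set W : ℝ := (ε / (c + 1)) ^ r⁻¹ with hW
  have hW0 : 0 < W := by positivity
  refine ⟨c * W ^ (r - q), by positivity, fun w hw => ?_⟩
  rcases le_or_gt w W with h | h
  · have h1 : w ^ r ≤ ε / (c + 1) := by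
      have := Real.rpow_le_rpow hw h hr.le
      rwa [hW, ← Real.rpow_mul (by positivity), inv_mul_cancel₀ hr.ne', Real.rpow_one] at this
    rw [le_div_iff₀ (by positivity)] at h1
    have : 0 ≤ w ^ r := by positivity
    have : 0 ≤ c * W ^ (r - q) * w ^ q := by positivity
    nlinarith
  · have hw' : 0 < w := hW0.trans h
    have h1 : w ^ (r - q) ≤ W ^ (r - q) :=
      Real.rpow_le_rpow_of_nonpos hW0 h.le (by linarith)
    have h2 : w ^ r = w ^ (r - q) * w ^ q := by
      rw [← Real.rpow_add hw']
      ring_nf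
    have : c * (w ^ (r - q) * w ^ q) ≤ c * (W ^ (r - q) * w ^ q) := by gcongr
    rw [h2]
    linarith

lemma one_add_rpow_le {r w : ℝ} (hr : 0 ≤ r) (hw : 0 ≤ w) :
    (1 + w) ^ r ≤ 2 ^ r * (1 + w ^ r) := by
  rcases le_total w 1 with h | h
  · have : (1 + w) ^ r ≤ 2 ^ r := Real.rpow_le_rpow (by positivity) (by linarith) hr
    have : 0 ≤ (2 : ℝ) ^ r * w ^ r := by positivity
    linarith
  · have : (1 + w) ^ r ≤ (2 * w) ^ r := Real.rpow_le_rpow (by positivity) (by linarith) hr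
    rw [Real.mul_rpow (by norm_num) hw] at this
    have : 0 ≤ (2 : ℝ) ^ r := by positivity
    linarith

/-- Lower powers of a cutoff times a subcritical power are absorbed by the critical power. -/
lemma exists_mul_rpow_mul_one_add_rpow_le {c δ r q σ n : ℝ} (hc : 0 ≤ c) (hδ : 0 < δ)
    (hr : 0 < r) (hrq : r < q) (hσ : σ ≤ n) (hn : σ * q / (q - r) ≤ n) :
    ∃ C : ℝ, 0 ≤ C ∧ ∀ φ v : ℝ, 0 < φ → φ ≤ 1 → 0 ≤ v →
      c * φ ^ (n - σ) * (1 + v) ^ r ≤ δ * (φ ^ n * v ^ q) + C := by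
  obtain ⟨C, hC, h⟩ := exists_mul_rpow_le_add (c := c * 2 ^ r) (by positivity) hδ hr.le hrq
  refine ⟨c * 2 ^ r + C, by positivity, fun φ v hφ hφ1 hv => ?_⟩
  have hq : 0 < q := hr.trans hrq
  have h1 := h (φ ^ (n / q) * v) (by positivity)
  rw [Real.mul_rpow (by positivity) hv, Real.mul_rpow (by positivity) hv, ← Real.rpow_mul hφ.le,
    ← Real.rpow_mul hφ.le, div_mul_cancel₀ _ hq.ne'] at h1
  have h2 : φ ^ (n - σ) ≤ φ ^ (n / q * r) := by
    refine Real.rpow_le_rpow_of_exponent_ge hφ hφ1 ?_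
    rw [div_le_iff₀ (by linarith)] at hn
    rw [div_mul_eq_mul_div, div_le_iff₀ hq]
    nlinarith
  have h3 : φ ^ (n - σ) ≤ 1 := Real.rpow_le_one hφ.le hφ1 (by linarith)
  have h4 := one_add_rpow_le hr.le hv
  calc c * φ ^ (n - σ) * (1 + v) ^ r ≤ c * φ ^ (n - σ) * (2 ^ r * (1 + v ^ r)) := by gcongr
    _ = c * 2 ^ r * φ ^ (n - σ) + c * 2 ^ r * (φ ^ (n - σ) * v ^ r) := by ring
    _ ≤ c * 2 ^ r * 1 + c * 2 ^ r * (φ ^ (n / q * r) * v ^ r) := by gcongr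
    _ ≤ _ := by linarith

lemma exists_scale_mul_one_add_rpow_le {c ε d p r q : ℝ} (hc : 0 ≤ c) (hε : 0 < ε) (hd : 0 < d)
    (hp : 1 < p) (hr : 0 < r) (hrq : r ≤ q) :
    ∃ K M : ℝ, 0 < K ∧ 0 ≤ M ∧ ∀ v : ℝ, 0 ≤ v →
      c * (d * K) ^ (1 - p) * (1 + K * v) ^ r ≤ ε + M * v ^ q := by
  set K : ℝ := (ε / (2 * (c * 2 ^ r + 1))) ^ (1 - p)⁻¹ / d with hK
  have hK0 : 0 < K := by positivity
  have hdK : (d * K) ^ (1 - p) = ε / (2 * (c * 2 ^ r + 1)) := by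
    rw [hK, mul_div_cancel₀ _ hd.ne', ← Real.rpow_mul (by positivity),
      inv_mul_cancel₀ (by linarith), Real.rpow_one]
  have h1 : c * (d * K) ^ (1 - p) * 2 ^ r ≤ ε / 2 := by
    rw [hdK, ← sub_nonneg]
    have : ε / 2 - c * (ε / (2 * (c * 2 ^ r + 1))) * 2 ^ r = ε / (2 * (c * 2 ^ r + 1)) := by
      field_simp
      ring
    rw [this]
    positivity
  obtain ⟨M, hM, h⟩ := exists_mul_rpow_le_add_mul
    (c := c * (d * K) ^ (1 - p) * 2 ^ r * K ^ r) (by positivity) (half_pos hε) hr hrq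
  refine ⟨K, M, hK0, hM, fun v hv => ?_⟩
  have h2 := h v hv
  have h3 := one_add_rpow_le hr.le (mul_nonneg hK0.le hv)
  rw [Real.mul_rpow hK0.le hv] at h3
  have h4 : c * (d * K) ^ (1 - p) * (1 + K * v) ^ r ≤
      c * (d * K) ^ (1 - p) * (2 ^ r * (1 + K ^ r * v ^ r)) := by gcongr
  linarith

lemma mul_rpow_sub_one_le {p y G b : ℝ} (hp : 1 < p) (hy : 0 ≤ y) (hG : 0 ≤ G) (hb : 0 < b) :
    y * G ^ (p - 1) ≤ b * G ^ p + y ^ p * b ^ (1 - p) := by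
  rcases hG.eq_or_lt with rfl | hG'
  · rw [Real.zero_rpow (by linarith), mul_zero]
    positivity
  rcases le_or_gt y (b * G) with h | h
  · have e : G ^ p = G * G ^ (p - 1) := by
      rw [show p = 1 + (p - 1) by ring, Real.rpow_add hG', Real.rpow_one]
      ring_nf
    have h1 : y * G ^ (p - 1) ≤ b * G * G ^ (p - 1) := by gcongr
    have h2 : 0 ≤ y ^ p * b ^ (1 - p) := by positivity
    rw [e]
    linarith
  · have hy' : 0 < y := (mul_pos hb hG').trans h
    have h1 : G ≤ y / b := by
      rw [le_div_iff₀ hb]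
      linarith
    have h2 : y * G ^ (p - 1) ≤ y * (y / b) ^ (p - 1) := by
      gcongr
    have h3 : y * (y / b) ^ (p - 1) = y ^ p * b ^ (1 - p) := by
      rw [Real.div_rpow hy hb.le, show (1 : ℝ) - p = -(p - 1) by ring, Real.rpow_neg hb.le]
      nth_rewrite 1 [← Real.rpow_one y]
      rw [mul_div_assoc', ← Real.rpow_add hy', div_eq_mul_inv]
      ring_nf
    have h4 : 0 ≤ b * G ^ p := by positivity
    linarith

/-- The decay weight used to build test functions out of the solution. -/
def decayWeight (d L v : ℝ) : ℝ := 1 + (1 + L * v) ^ (-d)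

/-- The derivative of `decayWeight d L`. -/
def decayWeightDeriv (d L v : ℝ) : ℝ := -(d * L * (1 + L * v) ^ (-d - 1))

/-- A primitive of `v ↦ v * decayWeightDeriv d L v`. -/
def decayWeightMoment (d L v : ℝ) : ℝ :=
  v * (1 + L * v) ^ (-d) - ((1 + L * v) ^ (1 - d) - 1) / (L * (1 - d))

section decayWeight

variable {d L v : ℝ}

lemma one_le_decayWeight (hL : 0 < L) (hv : 0 ≤ v) : 1 ≤ decayWeight d L v := by
  have : 0 ≤ (1 + L * v) ^ (-d) := by positivity
  rw [decayWeight]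
  linarith

lemma decayWeight_le_two (hd : 0 ≤ d) (hL : 0 < L) (hv : 0 ≤ v) : decayWeight d L v ≤ 2 := by
  have h0 : 0 ≤ L * v := by positivity
  have : (1 + L * v) ^ (-d) ≤ 1 := Real.rpow_le_one_of_one_le_of_nonpos (by linarith) (by linarith)
  rw [decayWeight]
  linarith

lemma contDiffAt_one_add_mul_rpow (hL : 0 < L) (hv : 0 ≤ v) (s : ℝ) :
    ContDiffAt ℝ 1 (fun v => (1 + L * v) ^ s) v := by
  have : 1 + L * v ≠ 0 := by positivity
  exact ContDiffAt.rpow_const_of_ne (by fun_prop) this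

lemma hasDerivAt_one_add_mul_rpow (hL : 0 < L) (hv : 0 ≤ v) (s : ℝ) :
    HasDerivAt (fun v => (1 + L * v) ^ s) (s * L * (1 + L * v) ^ (s - 1)) v := by
  have : 1 + L * v ≠ 0 := by positivity
  have h1 : HasDerivAt (fun v => 1 + L * v) L v := by
    simpa using ((hasDerivAt_id v).const_mul L).const_add 1
  convert h1.rpow_const (p := s) (Or.inl this) using 1
  ring

lemma contDiffAt_decayWeight (hL : 0 < L) (hv : 0 ≤ v) : ContDiffAt ℝ 1 (decayWeight d L) v :=
  contDiffAt_const.add (contDiffAt_one_add_mul_rpow hL hv (-d))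

lemma hasDerivAt_decayWeight (hL : 0 < L) (hv : 0 ≤ v) :
    HasDerivAt (decayWeight d L) (decayWeightDeriv d L v) v := by
  refine ((hasDerivAt_one_add_mul_rpow hL hv (-d)).const_add 1).congr_deriv ?_
  rw [decayWeightDeriv]
  ring

lemma contDiffAt_decayWeightMoment (hL : 0 < L) (hv : 0 ≤ v) :
    ContDiffAt ℝ 1 (decayWeightMoment d L) v :=
  (contDiffAt_id.mul (contDiffAt_one_add_mul_rpow hL hv (-d))).sub
    (((contDiffAt_one_add_mul_rpow hL hv (1 - d)).sub contDiffAt_const).div_const _)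

lemma hasDerivAt_decayWeightMoment (hd : d < 1) (hL : 0 < L) (hv : 0 ≤ v) :
    HasDerivAt (decayWeightMoment d L) (v * decayWeightDeriv d L v) v := by
  refine (((hasDerivAt_id v).mul (hasDerivAt_one_add_mul_rpow hL hv (-d))).sub
    (((hasDerivAt_one_add_mul_rpow hL hv (1 - d)).sub_const 1).div_const _)).congr_deriv ?_
  have h1 : 1 - d ≠ 0 := by linarith
  rw [decayWeightDeriv, show 1 - d - 1 = -d by ring]
  simp only [id]
  field_simp
  ring

lemma mul_decayWeight_sub_moment_nonneg (hd : d < 1) (hL : 0 < L) (hv : 0 ≤ v) :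
    0 ≤ v * decayWeight d L v - decayWeightMoment d L v := by
  have h0 : 0 ≤ L * v := by positivity
  have h1 : 1 ≤ (1 + L * v) ^ (1 - d) := Real.one_le_rpow (by linarith) (by linarith)
  have h2 : 0 ≤ ((1 + L * v) ^ (1 - d) - 1) / (L * (1 - d)) :=
    div_nonneg (by linarith) (mul_nonneg hL.le (by linarith))
  rw [decayWeight, decayWeightMoment]
  linarith

lemma mul_decayWeight_sub_moment_le (hd0 : 0 ≤ d) (hd : d < 1) (hL : 0 < L) (hv : 0 ≤ v) :
    v * decayWeight d L v - decayWeightMoment d L v ≤ 2 * v := by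
  have h0 : 0 ≤ L * v := by positivity
  have h1 : (1 + L * v) ^ (1 - d) ≤ 1 + (1 - d) * (L * v) :=
    rpow_one_add_le_one_add_mul_self (by linarith) (by linarith) (by linarith)
  have h2 : ((1 + L * v) ^ (1 - d) - 1) / (L * (1 - d)) ≤ v := by
    rw [div_le_iff₀ (mul_pos hL (by linarith))]
    linarith
  rw [decayWeight, decayWeightMoment]
  linarith

/-- Young's inequality for the flux term, absorbing the gradient of the solution. -/
lemma flux_le {p φ g G : ℝ} {n : ℕ} (hp : 1 < p) (hn : 2 ≤ n) (hd0 : 0 < d) (hL : 0 < L)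
    (hv : 0 ≤ v) (hφ : 0 ≤ φ) (hg : 0 ≤ g) (hG : 0 ≤ G) :
    n * φ ^ (n - 1) * decayWeight d L v * g * G ^ (p - 1)
        + φ ^ n * decayWeightDeriv d L v * G ^ p ≤
      (2 * n * g) ^ p * (d * L) ^ (1 - p) * φ ^ (n - p) * (1 + L * v) ^ ((d + 1) * (p - 1)) := by
  rcases hφ.eq_or_lt with rfl | hφ'
  · rw [zero_pow (by omega), zero_pow (by omega)]
    simp only [mul_zero, zero_mul, add_zero]
    positivity
  have hw : 0 < 1 + L * v := by positivity
  have hh := decayWeight_le_two hd0.le hL hv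
  have hh1 := one_le_decayWeight (d := d) hL hv
  have hy := mul_rpow_sub_one_le (y := n * decayWeight d L v * g / φ)
    (b := d * L * (1 + L * v) ^ (-d - 1)) hp (by positivity) hG (by positivity)
  have e1 : (d * L * (1 + L * v) ^ (-d - 1)) ^ (1 - p) =
      (d * L) ^ (1 - p) * (1 + L * v) ^ ((d + 1) * (p - 1)) := by
    rw [Real.mul_rpow (by positivity) (by positivity), ← Real.rpow_mul hw.le]
    ring_nf
  have e2 : (n * decayWeight d L v * g / φ) ^ p ≤ (2 * n * g) ^ p * φ ^ (-p) := by
    rw [Real.rpow_neg hφ, ← div_eq_mul_inv, ← Real.div_rpow (by positivity) hφ]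
    gcongr ?_ ^ p
    gcongr ?_ / φ
    calc n * decayWeight d L v * g ≤ n * 2 * g := by gcongr
      _ = _ := by ring
  have e3 : φ ^ n * φ ^ (-p) = φ ^ (n - p) := by
    rw [← Real.rpow_natCast, ← Real.rpow_add hφ', sub_eq_add_neg]
  have e4 : φ ^ n = φ ^ (n - 1) * φ := by
    rw [← pow_succ]
    congr 1
    omega
  have e5 : φ ^ n * (n * decayWeight d L v * g / φ * G ^ (p - 1)) =
      n * φ ^ (n - 1) * decayWeight d L v * g * G ^ (p - 1) := by
    rw [e4]
    field_simp
  have h1 := mul_le_mul_of_nonneg_left hy (pow_nonneg hφ n)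
  rw [e5, e1] at h1
  have h2 : φ ^ n * ((n * decayWeight d L v * g / φ) ^ p *
      ((d * L) ^ (1 - p) * (1 + L * v) ^ ((d + 1) * (p - 1)))) ≤
      φ ^ n * ((2 * n * g) ^ p * φ ^ (-p) *
      ((d * L) ^ (1 - p) * (1 + L * v) ^ ((d + 1) * (p - 1)))) := by gcongr
  have h3 : φ ^ n * ((2 * n * g) ^ p * φ ^ (-p) *
      ((d * L) ^ (1 - p) * (1 + L * v) ^ ((d + 1) * (p - 1)))) = (2 * n * g) ^ p *
      (d * L) ^ (1 - p) * φ ^ (n - p) * (1 + L * v) ^ ((d + 1) * (p - 1)) := by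
    rw [← e3]
    ring
  rw [decayWeightDeriv]
  linarith

end decayWeight

lemma deriv_smoothTransition_of_nonpos {x : ℝ} (hx : x ≤ 0) :
    deriv Real.smoothTransition x = 0 := by
  refine IsLocalMin.deriv_eq_zero (Filter.Eventually.of_forall fun y => ?_)
  rw [Real.smoothTransition.zero_of_nonpos hx]
  exact Real.smoothTransition.nonneg y

lemma deriv_smoothTransition_of_one_le {x : ℝ} (hx : 1 ≤ x) :
    deriv Real.smoothTransition x = 0 := by
  refine IsLocalMax.deriv_eq_zero (Filter.Eventually.of_forall fun y => ?_)
  rw [Real.smoothTransition.one_of_one_le hx]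
  exact Real.smoothTransition.le_one y

lemma deriv_smoothTransition_nonneg (x : ℝ) : 0 ≤ deriv Real.smoothTransition x :=
  Real.smoothTransition.monotone.deriv_nonneg

lemma exists_abs_deriv_smoothTransition_le :
    ∃ C : ℝ, 0 ≤ C ∧ ∀ x, |deriv Real.smoothTransition x| ≤ C := by
  have hc : Continuous (deriv Real.smoothTransition) :=
    (Real.smoothTransition.contDiff (n := 1)).continuous_deriv le_rfl
  obtain ⟨C, hC⟩ := (isCompact_Icc (a := (0 : ℝ)) (b := 1)).exists_bound_of_continuousOn
    hc.continuousOn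
  refine ⟨max C 0, le_max_right _ _, fun x => ?_⟩
  rcases le_total x 0 with h0 | h0
  · rw [deriv_smoothTransition_of_nonpos h0, abs_zero]
    exact le_max_right _ _
  rcases le_total 1 x with h1 | h1
  · rw [deriv_smoothTransition_of_one_le h1, abs_zero]
    exact le_max_right _ _
  · exact (hC x ⟨h0, h1⟩).trans (le_max_left _ _)

/-- The closed parabolic cylinder of radius `r` over the time interval `[s, t]`. -/
def parabolicCylinder (N : ℕ) (r s t : ℝ) : Set (Euc N × ℝ) := closedBall 0 r ×ˢ Set.Icc s t

lemma isCompact_parabolicCylinder (N : ℕ) (r s t : ℝ) : IsCompact (parabolicCylinder N r s t) :=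
  (isCompact_closedBall 0 r).prod isCompact_Icc

lemma parabolicCylinder_subset_Sset (N : ℕ) (r : ℝ) {s : ℝ} (t : ℝ) (hs : 0 < s) :
    parabolicCylinder N r s t ⊆ Sset N := fun _ hz => hs.trans_le hz.2.1

/-- A space-time cutoff function with the natural gradient and time derivative bounds. -/
lemma exists_cutoff (N : ℕ) : ∃ C : ℝ, 0 ≤ C ∧ ∀ R T : ℝ, 0 < R → 0 < T →
    ∃ (φ : Euc N × ℝ → ℝ) (gφ : Euc N × ℝ → Euc N) (tφ : Euc N × ℝ → ℝ),
      ContDiff ℝ 1 φ ∧ (∀ z, 0 ≤ φ z) ∧ (∀ z, φ z ≤ 1) ∧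
      (∀ z, HasFDerivAt φ (pairCLM (gφ z) (tφ z)) z) ∧
      tsupport φ ⊆ parabolicCylinder N (2 * R) (1 / R) (2 * T) ∧
      (∀ z ∈ parabolicCylinder N R (2 / R) T, φ z = 1 ∧ gφ z = 0 ∧ tφ z = 0) ∧
      (∀ z, ‖gφ z‖ ≤ C / R) ∧ ∀ z, -tφ z ≤ C / T := by
  obtain ⟨C, hC0, hC⟩ := exists_abs_deriv_smoothTransition_le
  refine ⟨4 * C, by positivity, fun R T hR hT => ?_⟩
  set σ := Real.smoothTransition with hσ
  have hσd : ContDiff ℝ 1 σ := Real.smoothTransition.contDiff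
  have hσ' : ∀ x, HasDerivAt σ (deriv σ x) x := fun x =>
    ((hσd.differentiable one_ne_zero) x).hasDerivAt
  have σ0 : ∀ x, 0 ≤ σ x := Real.smoothTransition.nonneg
  have σ1 : ∀ x, σ x ≤ 1 := Real.smoothTransition.le_one
  set A : Euc N × ℝ → ℝ := fun z => 2 - ‖z.1‖ ^ 2 / R ^ 2 with hA
  set b : Euc N × ℝ → ℝ := fun z => 2 - z.2 / T with hb
  set c : Euc N × ℝ → ℝ := fun z => R * z.2 - 1 with hc
  have hAd : ∀ z, HasFDerivAt A (pairCLM ((-(2 / R ^ 2)) • z.1) 0) z := fun z => by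
    have h1 : HasFDerivAt (fun z : Euc N × ℝ => ‖z.1‖ ^ 2) _ z := hasFDerivAt_fst.norm_sq
    refine ((h1.mul_const (R ^ 2)⁻¹).const_sub 2).congr_fderiv ?_
    ext w <;> simp [pairCLM]
    ring
  have hbd : ∀ z, HasFDerivAt b (pairCLM 0 (-(1 / T))) z := fun z => by
    have h1 : HasFDerivAt (fun z : Euc N × ℝ => z.2)
        (ContinuousLinearMap.snd ℝ (Euc N) ℝ) z := hasFDerivAt_snd
    refine ((h1.mul_const T⁻¹).const_sub 2).congr_fderiv ?_
    ext w <;> simp [pairCLM]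
  have hcd : ∀ z, HasFDerivAt c (pairCLM 0 R) z := fun z => by
    have h1 : HasFDerivAt (fun z : Euc N × ℝ => z.2)
        (ContinuousLinearMap.snd ℝ (Euc N) ℝ) z := hasFDerivAt_snd
    refine ((h1.const_mul R).sub_const 1).congr_fderiv ?_
    ext w <;> simp [pairCLM]
  have hA1 : ContDiff ℝ 1 A :=
    contDiff_const.sub ((contDiff_fst.norm_sq ℝ).div_const _)
  have hb1 : ContDiff ℝ 1 b := contDiff_const.sub (contDiff_snd.div_const _)
  have hc1 : ContDiff ℝ 1 c := (contDiff_const.mul contDiff_snd).sub contDiff_const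
  refine ⟨fun z => σ (A z) * (σ (b z) * σ (c z)),
    fun z => (-(2 / R ^ 2) * (σ (b z) * σ (c z)) * deriv σ (A z)) • z.1,
    fun z => σ (A z) * (R * deriv σ (c z) * σ (b z) - 1 / T * deriv σ (b z) * σ (c z)),
    (hσd.comp hA1).mul ((hσd.comp hb1).mul (hσd.comp hc1)), fun z => ?_, fun z => ?_,
    fun z => ?_, ?_, fun z hz => ?_, fun z => ?_, fun z => ?_⟩
  · have := σ0 (A z)
    have := σ0 (b z)
    have := σ0 (c z)
    positivity
  · exact mul_le_one₀ (σ1 _) (mul_nonneg (σ0 _) (σ0 _)) (mul_le_one₀ (σ1 _) (σ0 _) (σ1 _))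
  · refine (((hσ' _).comp_hasFDerivAt z (hAd z)).mul (((hσ' _).comp_hasFDerivAt z (hbd z)).mul
      ((hσ' _).comp_hasFDerivAt z (hcd z)))).congr_fderiv ?_
    ext w
    · simp [pairCLM]
      ring
    · simp [pairCLM]
      ring
  · refine closure_minimal (fun z hz => ?_) (isCompact_parabolicCylinder N _ _ _).isClosed
    have hz1 : σ (A z) ≠ 0 := fun h => hz (by simp [h])
    have hz2 : σ (b z) ≠ 0 := fun h => hz (by simp [h])
    have hz3 : σ (c z) ≠ 0 := fun h => hz (by simp [h])
    have p1 : 0 < A z := by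
      by_contra! h
      exact hz1 (Real.smoothTransition.zero_of_nonpos h)
    have p2 : 0 < b z := by
      by_contra! h
      exact hz2 (Real.smoothTransition.zero_of_nonpos h)
    have p3 : 0 < c z := by
      by_contra! h
      exact hz3 (Real.smoothTransition.zero_of_nonpos h)
    simp only [hA, hb, hc, sub_pos] at p1 p2 p3
    rw [div_lt_iff₀ (by positivity)] at p1 p2
    refine ⟨?_, ?_, p2.le⟩
    · rw [mem_closedBall_zero_iff]
      nlinarith [norm_nonneg z.1]
    · rw [div_le_iff₀ hR]
      linarith
  · obtain ⟨hz1, hz2, hz3⟩ := hz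
    rw [mem_closedBall_zero_iff] at hz1
    rw [div_le_iff₀ hR] at hz2
    have p1 : 1 ≤ A z := by
      have : ‖z.1‖ ^ 2 / R ^ 2 ≤ 1 := by
        rw [div_le_one (by positivity)]
        gcongr
      simp only [hA]
      linarith
    have p2 : 1 ≤ b z := by
      have : z.2 / T ≤ 1 := by rwa [div_le_one hT]
      simp only [hb]
      linarith
    have p3 : 1 ≤ c z := by
      simp only [hc]
      linarith
    simp only [hσ, Real.smoothTransition.one_of_one_le p1, Real.smoothTransition.one_of_one_le p2,
      Real.smoothTransition.one_of_one_le p3, deriv_smoothTransition_of_one_le p1,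
      deriv_smoothTransition_of_one_le p2, deriv_smoothTransition_of_one_le p3]
    simp
  · rw [norm_smul, Real.norm_eq_abs, abs_mul, abs_mul, abs_neg,
      abs_of_nonneg (by positivity : 0 ≤ 2 / R ^ 2),
      abs_of_nonneg (mul_nonneg (σ0 _) (σ0 _))]
    have hbc : σ (b z) * σ (c z) ≤ 1 := mul_le_one₀ (σ1 _) (σ0 _) (σ1 _)
    have hbc0 : 0 ≤ σ (b z) * σ (c z) := mul_nonneg (σ0 _) (σ0 _)
    rcases le_total ‖z.1‖ (2 * R) with h | h
    · calc 2 / R ^ 2 * (σ (b z) * σ (c z)) * |deriv σ (A z)| * ‖z.1‖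
          ≤ 2 / R ^ 2 * 1 * C * (2 * R) := by
            gcongr
            exact hC _
        _ = 4 * C / R := by
            field_simp
            ring
    · have hA0 : A z ≤ 0 := by
        simp only [hA, sub_nonpos]
        rw [le_div_iff₀ (by positivity)]
        nlinarith
      rw [hσ, deriv_smoothTransition_of_nonpos hA0]
      simp only [abs_zero, mul_zero, zero_mul]
      positivity
  · have e1 : 0 ≤ R * deriv σ (c z) * σ (b z) :=
      mul_nonneg (mul_nonneg hR.le (deriv_smoothTransition_nonneg _)) (σ0 _)
    have e2 : 1 / T * deriv σ (b z) * σ (c z) ≤ 1 / T * C * 1 := by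
      have := σ0 (c z)
      have := σ1 (c z)
      have := (le_abs_self _).trans (hC (b z))
      gcongr
    have e3 : σ (A z) * (1 / T * C * 1 - (1 / T * deriv σ (b z) * σ (c z)
        - R * deriv σ (c z) * σ (b z))) ≥ 0 := mul_nonneg (σ0 _) (by linarith)
    have e4 : σ (A z) * (1 / T * C * 1) ≤ 1 * (1 / T * C * 1) := by
      have := σ1 (A z)
      gcongr
    have e5 : 1 / T * C * 1 ≤ 4 * C / T := by
      rw [mul_one, one_div, mul_comm, ← div_eq_mul_inv]
      gcongr
      linarith
    linarith

/-- The scale-invariant energy estimate over the cylinder of radius `R` and height `R ^ θ`. -/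
lemma IsWeakSol.exists_energy_estimate {N : ℕ} {p q κ θ d : ℝ} (hp : 1 < p) (hq : 0 < q)
    (hκ : κ * q = p + κ * (p - 1)) (hθ : κ * q = θ + κ) (hd0 : 0 < d) (hd1 : d < 1)
    {a : Euc N → ℝ} (haLip : LocallyLipschitz a) (ha0 : ∀ x, 0 ≤ a x)
    {u : Euc N × ℝ → ℝ} {gu : Euc N × ℝ → Euc N} {ut : Euc N × ℝ → ℝ}
    (hu : IsWeakSol N p 1 q (fun _ => 1) (fun _ => 1) a u gu ut) {n : ℕ} (hn : 2 ≤ n) :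
    ∃ c : ℝ, 0 ≤ c ∧ ∀ R : ℝ, 0 < R → ∃ φ : Euc N × ℝ → ℝ, Continuous φ ∧ (∀ z, 0 ≤ φ z) ∧
      (∀ z, φ z ≤ 1) ∧ (∀ z ∈ parabolicCylinder N R (2 / R) (R ^ θ), φ z = 1) ∧
      (∀ z, z ∉ parabolicCylinder N (2 * R) (1 / R) (2 * R ^ θ) → φ z = 0) ∧
      ∀ K : ℝ, 0 < K → ∀ b : Euc N × ℝ → ℝ, Integrable b (muS a) →
        (∀ z ∈ Sset N, 0 ≤ b z) →
        (∀ z ∈ parabolicCylinder N (2 * R) (1 / R) (2 * R ^ θ),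
          z ∉ parabolicCylinder N R (2 / R) (R ^ θ) →
          0 < φ z →
          R ^ (-(κ * q)) * (c * (d * K) ^ (1 - p) * φ z ^ (n - p) *
            (1 + K * (R ^ κ * u z)) ^ ((d + 1) * (p - 1))) ≤ b z ∧
          R ^ (-(κ * q)) * (c * φ z ^ (n - 1 : ℝ) * (R ^ κ * u z)) ≤ b z) →
        ∫ z, φ z ^ n * u z ^ q ∂(muS a) ≤ 2 * ∫ z, b z ∂(muS a) := by
  obtain ⟨C, hC, hcut⟩ := exists_cutoff N
  refine ⟨max ((2 * n * C) ^ p) (2 * n * C), le_max_of_le_right (by positivity),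
    fun R hR => ?_⟩
  have hT : 0 < R ^ θ := by positivity
  obtain ⟨φ, gφ, tφ, hφ, hφ0, hφ1, hφd, hφS, hφG, hg, ht⟩ := hcut R (R ^ θ) hR hT
  have hout : ∀ z, z ∉ parabolicCylinder N (2 * R) (1 / R) (2 * R ^ θ) → φ z = 0 := fun z hz =>
    image_eq_zero_of_notMem_tsupport fun h => hz (hφS h)
  refine ⟨φ, hφ.continuous, hφ0, hφ1, fun z hz => (hφG z hz).1, hout,
    fun K hK b hb hb0 hbnd => ?_⟩
  have hL : 0 < K * R ^ κ := by positivity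
  have hφc : HasCompactSupport φ :=
    (isCompact_parabolicCylinder N _ _ _).of_isClosed_subset (isClosed_tsupport φ) hφS
  have hzero : ∀ z, φ z = 0 ∨ z ∈ parabolicCylinder N R (2 / R) (R ^ θ) ∨
      (0 < φ z ∧ z ∈ parabolicCylinder N (2 * R) (1 / R) (2 * R ^ θ) ∧
        z ∉ parabolicCylinder N R (2 / R) (R ^ θ)) := fun z => by
    rcases (hφ0 z).eq_or_lt with h | h
    · exact Or.inl h.symm
    · by_cases hG : z ∈ parabolicCylinder N R (2 / R) (R ^ θ)
      · exact Or.inr (Or.inl hG)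
      · refine Or.inr (Or.inr ⟨h, ?_, hG⟩)
        by_contra hQ
        exact h.ne' (hout z hQ)
  refine hu.integral_pow_mul_le hp hq haLip ha0 hφ hφ0 hφc
    (hφS.trans (parabolicCylinder_subset_Sset N _ _ (by positivity))) hφd
    (h := decayWeight d (K * R ^ κ)) (h' := decayWeightDeriv d (K * R ^ κ))
    (P := decayWeightMoment d (K * R ^ κ))
    (fun v hv => contDiffAt_decayWeight hL hv) (fun v hv => hasDerivAt_decayWeight hL hv)
    (fun v hv => contDiffAt_decayWeightMoment hL hv)
    (fun v hv => hasDerivAt_decayWeightMoment hd1 hL hv)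
    (fun v hv => one_le_decayWeight hL hv) hn hb hb0 (fun z hz G hG => ?_) fun z hz => ?_
  · have hv := hu.nonneg z hz
    rcases hzero z with h | h | ⟨h, hQ, hG'⟩
    · rw [h, zero_pow (by omega), zero_pow (by omega)]
      simpa using hb0 z hz
    · obtain ⟨h1, h2, -⟩ := hφG z h
      have : 0 ≤ d * (K * R ^ κ) * (1 + K * R ^ κ * u z) ^ (-d - 1) * G ^ p := by positivity
      have := hb0 z hz
      rw [h1, h2, norm_zero, decayWeightDeriv]
      simp only [one_pow, mul_zero, zero_mul]
      linarith
    · refine (flux_le hp hn hd0 hL hv (hφ0 z) (norm_nonneg _) hG).trans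
        (le_trans ?_ (hbnd z hQ hG' h).1)
      have e1 : (2 * n * ‖gφ z‖) ^ p ≤ (2 * n * C) ^ p * R ^ (-p) := by
        rw [Real.rpow_neg hR.le, ← div_eq_mul_inv, ← Real.div_rpow (by positivity) hR.le,
          mul_div_assoc]
        have := hg z
        gcongr
      have e2 : (d * (K * R ^ κ)) ^ (1 - p) = (d * K) ^ (1 - p) * R ^ (κ * (1 - p)) := by
        rw [← mul_assoc, Real.mul_rpow (by positivity) (by positivity), ← Real.rpow_mul hR.le]
      have e3 : R ^ (-(κ * q)) = R ^ (-p) * R ^ (κ * (1 - p)) := by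
        rw [← Real.rpow_add hR, hκ]
        ring_nf
      have e4 : (2 * n * C) ^ p ≤ max ((2 * n * C) ^ p) (2 * n * C) := le_max_left _ _
      rw [e2, e3, mul_assoc K]
      calc _ ≤ max ((2 * n * C) ^ p) (2 * n * C) * R ^ (-p) *
            ((d * K) ^ (1 - p) * R ^ (κ * (1 - p))) * φ z ^ (n - p) *
            (1 + K * (R ^ κ * u z)) ^ ((d + 1) * (p - 1)) := by
            have := e1.trans (mul_le_mul_of_nonneg_right e4 (by positivity : 0 ≤ R ^ (-p)))
            gcongr
        _ = _ := by ring
  · have hv := hu.nonneg z hz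
    rcases hzero z with h | h | ⟨h, hQ, hG'⟩
    · rw [h, zero_pow (by omega)]
      simpa using hb0 z hz
    · rw [(hφG z h).2.2]
      simpa using hb0 z hz
    · refine le_trans ?_ (hbnd z hQ hG' h).2
      have e1 := mul_decayWeight_sub_moment_nonneg hd1 hL hv
      have e2 := mul_decayWeight_sub_moment_le hd0.le hd1 hL hv
      have e3 : R ^ (-(κ * q)) * R ^ κ = (R ^ θ)⁻¹ := by
        rw [← Real.rpow_add hR, hθ, ← Real.rpow_neg hR.le]
        ring_nf
      have e4 : 2 * n * C ≤ max ((2 * n * C) ^ p) (2 * n * C) := le_max_right _ _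
      have e5 : φ z ^ (n - 1 : ℝ) = φ z ^ (n - 1) := by
        rw [← Real.rpow_natCast, Nat.cast_sub (by omega), Nat.cast_one]
      have hφz := hφ0 z
      calc -(n * φ z ^ (n - 1) * tφ z * (u z * decayWeight d (K * R ^ κ) (u z) -
              decayWeightMoment d (K * R ^ κ) (u z)))
          = n * φ z ^ (n - 1) * (u z * decayWeight d (K * R ^ κ) (u z) -
              decayWeightMoment d (K * R ^ κ) (u z)) * -tφ z := by ring
        _ ≤ n * φ z ^ (n - 1) * (u z * decayWeight d (K * R ^ κ) (u z) -
              decayWeightMoment d (K * R ^ κ) (u z)) * (C / R ^ θ) := by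
            have := ht z
            gcongr
        _ ≤ n * φ z ^ (n - 1) * (2 * u z) * (C / R ^ θ) := by gcongr
        _ = 2 * n * C * (φ z ^ (n - 1) * u z * (R ^ θ)⁻¹) := by ring
        _ ≤ max ((2 * n * C) ^ p) (2 * n * C) * (φ z ^ (n - 1) * u z * (R ^ θ)⁻¹) := by gcongr
        _ = _ := by
            rw [e5, ← e3]
            ring

lemma exists_muS_real_parabolicCylinder_le {N : ℕ} {a : Euc N → ℝ} {Ca : ℝ} (hCa : ∀ x, a x ≤ Ca)
    {κ θ : ℝ} (hκ : (N : ℝ) ≤ κ) :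
    ∃ C : ℝ, 0 ≤ C ∧ ∀ R : ℝ, 1 ≤ R →
      (muS a).real (parabolicCylinder N (2 * R) (1 / R) (2 * R ^ θ)) ≤ C * R ^ (θ + κ) := by
  set v : ℝ := (volume : Measure (Euc N)).real (ball 0 1) with hv
  refine ⟨max Ca 0 * (2 ^ N * v) * 2, by positivity, fun R hR => ?_⟩
  have hR0 : 0 < R := by linarith
  have h1 : muA a (closedBall 0 (2 * R)) ≤ ENNReal.ofReal (max Ca 0 * ((2 * R) ^ N * v)) := by
    calc muA a (closedBall 0 (2 * R))
        ≤ ∫⁻ _ in closedBall (0 : Euc N) (2 * R), ENNReal.ofReal (max Ca 0) := by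
          rw [muA, withDensity_apply _ isClosed_closedBall.measurableSet]
          exact lintegral_mono fun x => ENNReal.ofReal_le_ofReal ((hCa x).trans (le_max_left _ _))
      _ = _ := by
          rw [setLIntegral_const, Measure.addHaar_closedBall _ _ (by positivity),
            finrank_euclideanSpace_fin, ENNReal.ofReal_mul (by positivity),
            ENNReal.ofReal_mul (by positivity), hv, measureReal_def,
            ENNReal.ofReal_toReal measure_ball_lt_top.ne]
  have h2 : ((volume : Measure ℝ).restrict (Set.Ioi 0)) (Set.Icc (1 / R) (2 * R ^ θ)) ≤
      ENNReal.ofReal (2 * R ^ θ) := by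
    refine (Measure.restrict_apply_le _ _).trans ?_
    rw [Real.volume_Icc]
    refine ENNReal.ofReal_le_ofReal ?_
    have : 0 ≤ 1 / R := by positivity
    linarith
  have h3 : muS a (parabolicCylinder N (2 * R) (1 / R) (2 * R ^ θ)) ≤
      ENNReal.ofReal (max Ca 0 * ((2 * R) ^ N * v) * (2 * R ^ θ)) := by
    rw [muS, parabolicCylinder, Measure.prod_prod, ENNReal.ofReal_mul (by positivity)]
    gcongr
  have h4 : R ^ N ≤ R ^ κ := by
    rw [← Real.rpow_natCast]
    exact Real.rpow_le_rpow_of_exponent_le hR hκ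
  refine (ENNReal.toReal_le_of_le_ofReal (by positivity) h3).trans ?_
  rw [Real.rpow_add hR0]
  calc max Ca 0 * ((2 * R) ^ N * v) * (2 * R ^ θ)
      = max Ca 0 * (2 ^ N * v) * 2 * (R ^ θ * R ^ N) := by
        rw [mul_pow]
        ring
    _ ≤ _ := by gcongr

lemma aecover_parabolicCylinder {N : ℕ} {a : Euc N → ℝ} (ha : Continuous a) {θ : ℝ} (hθ : 0 < θ) :
    AECover (muS a) Filter.atTop fun k : ℕ =>
      parabolicCylinder N (k + 1 : ℝ) (2 / (k + 1 : ℝ)) ((k + 1 : ℝ) ^ θ) := by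
  have hk : Filter.Tendsto (fun k : ℕ => (k + 1 : ℝ)) Filter.atTop Filter.atTop :=
    Filter.tendsto_atTop_add_const_right _ _ tendsto_natCast_atTop_atTop
  refine ⟨?_, fun k => (isCompact_parabolicCylinder N _ _ _).isClosed.measurableSet⟩
  filter_upwards [ae_muS_mem_Sset ha] with z hz
  have h2 : Filter.Tendsto (fun k : ℕ => 2 / (k + 1 : ℝ)) Filter.atTop (nhds 0) :=
    hk.const_div_atTop 2
  filter_upwards [hk.eventually_ge_atTop ‖z.1‖, h2.eventually_le_const hz,
    ((tendsto_rpow_atTop hθ).comp hk).eventually_ge_atTop z.2] with k h1 h2 h3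
  exact ⟨mem_closedBall_zero_iff.2 h1, h2, h3⟩

lemma IsWeakSol.integrableOn_rpow {N : ℕ} {p m q : ℝ} {a : Euc N → ℝ} {V : Euc N × ℝ → ℝ}
    {f : ℝ → ℝ} {u : Euc N × ℝ → ℝ} {gu : Euc N × ℝ → Euc N} {ut : Euc N × ℝ → ℝ}
    (hu : IsWeakSol N p m q V f a u gu ut) (ha : Continuous a) (hq : 0 < q)
    {K : Set (Euc N × ℝ)} (hK : IsCompact K) (hKS : K ⊆ Sset N) :
    IntegrableOn (fun z => u z ^ q) K (muS a) := by
  have := isLocallyFiniteMeasure_muS ha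
  exact ((hu.locLip.continuousOn.mono hKS).rpow_const fun z _ => Or.inr hq.le).integrableOn_compact
    hK

/-- Integrating over the region where a cutoff equals one. -/
lemma IsWeakSol.setIntegral_rpow_le {N : ℕ} {p m q : ℝ} {a : Euc N → ℝ} {V : Euc N × ℝ → ℝ}
    {f : ℝ → ℝ} {u : Euc N × ℝ → ℝ} {gu : Euc N × ℝ → Euc N} {ut : Euc N × ℝ → ℝ}
    (hu : IsWeakSol N p m q V f a u gu ut) (ha : Continuous a) (hq : 0 < q)
    {K G : Set (Euc N × ℝ)} (hK : IsCompact K) (hKS : K ⊆ Sset N) (hG : IsCompact G)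
    {φ : Euc N × ℝ → ℝ} (hφ : Continuous φ) (hφ0 : ∀ z, 0 ≤ φ z) (hφG : ∀ z ∈ G, φ z = 1)
    (hφK : ∀ z, z ∉ K → φ z = 0) {n : ℕ} (hn : n ≠ 0) :
    Integrable (fun z => φ z ^ n * u z ^ q) (muS a) ∧
      ∫ z in G, u z ^ q ∂(muS a) ≤ ∫ z, φ z ^ n * u z ^ q ∂(muS a) := by
  have hi : Integrable (fun z => φ z ^ n * u z ^ q) (muS a) := by
    refine integrable_muS_of_continuousOn ha hK hKS ((hφ.pow n).continuousOn.mul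
      (hu.locLip.continuousOn.rpow_const fun z _ => Or.inr hq.le)) fun z hz => ?_
    simp [hφK z hz, hn]
  refine ⟨hi, ?_⟩
  have e : ∫ z in G, u z ^ q ∂(muS a) = ∫ z in G, φ z ^ n * u z ^ q ∂(muS a) :=
    setIntegral_congr_fun hG.isClosed.measurableSet fun z hz => by simp [hφG z hz]
  rw [e]
  refine setIntegral_le_integral hi ?_
  filter_upwards [ae_muS_mem_Sset ha] with z hz
  exact mul_nonneg (pow_nonneg (hφ0 z) n) (Real.rpow_nonneg (hu.nonneg z hz) q)

section Liouville

variable {N : ℕ} {p q κ θ d : ℝ} {a : Euc N → ℝ} {u : Euc N × ℝ → ℝ} {gu : Euc N × ℝ → Euc N}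
  {ut : Euc N × ℝ → ℝ}

lemma IsWeakSol.integrable_rpow (hp : 1 < p) (hq : 1 < q) (hκ : κ * q = p + κ * (p - 1))
    (hθ : κ * q = θ + κ) (hθ0 : 0 < θ) (hNκ : (N : ℝ) ≤ κ) (hd0 : 0 < d) (hd1 : d < 1)
    (hdq : (d + 1) * (p - 1) < q) (haLip : LocallyLipschitz a) (ha0 : ∀ x, 0 ≤ a x)
    (haBdd : ∃ Ca, ∀ x, a x ≤ Ca)
    (hu : IsWeakSol N p 1 q (fun _ => 1) (fun _ => 1) a u gu ut) :
    Integrable (fun z => u z ^ q) (muS a) := by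
  have haC := haLip.continuous
  have hq0 : 0 < q := by linarith
  have := isLocallyFiniteMeasure_muS haC
  obtain ⟨Ca, hCa⟩ := haBdd
  obtain ⟨n, hn⟩ := exists_nat_ge
    (2 + p + p * q / (q - (d + 1) * (p - 1)) + 1 * q / (q - 1))
  have hr : 0 < (d + 1) * (p - 1) := mul_pos (by linarith) (by linarith)
  have hn1 : 0 ≤ p * q / (q - (d + 1) * (p - 1)) := div_nonneg (by positivity) (by linarith)
  have hn2 : 0 ≤ 1 * q / (q - 1) := div_nonneg (by linarith) (by linarith)
  have hn3 : 2 ≤ n := by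
    have : (2 : ℝ) ≤ n := by linarith
    exact_mod_cast this
  obtain ⟨c, hc, henergy⟩ := hu.exists_energy_estimate hp hq0 hκ hθ hd0 hd1 haLip ha0 hn3
  obtain ⟨C₁, hC₁, h₁⟩ := exists_mul_rpow_mul_one_add_rpow_le (c := c * (d * 1) ^ (1 - p))
    (δ := 1 / 4) (n := n) (σ := p) (by positivity) (by norm_num) hr hdq (by linarith) (by linarith)
  obtain ⟨C₂, hC₂, h₂⟩ := exists_mul_rpow_mul_one_add_rpow_le (c := c)
    (δ := 1 / 4) (n := n) (σ := 1) hc (by norm_num) one_pos hq (by linarith) (by linarith)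
  obtain ⟨Cv, hCv, hvol⟩ := exists_muS_real_parabolicCylinder_le (θ := θ) hCa hNκ
  refine (aecover_parabolicCylinder haC hθ0).integrable_of_integral_bounded_of_nonneg_ae
    (4 * (C₁ + C₂) * Cv) (fun k => ?_) ?_ (Filter.Eventually.of_forall fun k => ?_)
  · exact hu.integrableOn_rpow haC hq0 (isCompact_parabolicCylinder N _ _ _)
      (parabolicCylinder_subset_Sset N _ _ (by positivity))
  · filter_upwards [ae_muS_mem_Sset haC] with z hz
    exact Real.rpow_nonneg (hu.nonneg z hz) q
  set R : ℝ := k + 1 with hR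
  have hR1 : 1 ≤ R := by simp [hR]
  have hR0 : 0 < R := by linarith
  obtain ⟨φ, hφ, hφ0, hφ1, hφG, hφQ, hφe⟩ := henergy R hR0
  set Q := parabolicCylinder N (2 * R) (1 / R) (2 * R ^ θ) with hQdef
  have hQ : IsCompact Q := isCompact_parabolicCylinder N _ _ _
  have hQS : Q ⊆ Sset N := parabolicCylinder_subset_Sset N _ _ (by positivity)
  obtain ⟨hi, hGle⟩ := hu.setIntegral_rpow_le haC hq0 hQ hQS
      (isCompact_parabolicCylinder N _ _ _) hφ hφ0
    hφG hφQ (n := n) (by omega)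
  have hiQ : Integrable (Q.indicator fun _ => R ^ (-(κ * q)) * (C₁ + C₂)) (muS a) :=
    (integrable_indicator_iff hQ.isClosed.measurableSet).2
      (integrableOn_const hQ.measure_lt_top.ne)
  have hX := hφe 1 one_pos (fun z => 1 / 4 * (φ z ^ n * u z ^ q) +
    Q.indicator (fun _ => R ^ (-(κ * q)) * (C₁ + C₂)) z) ((hi.const_mul _).add hiQ)
    (fun z hz => ?_) fun z hzQ hzG hφz => ?_
  · rw [integral_add (hi.const_mul _) hiQ, integral_const_mul,
      integral_indicator_const _ hQ.isClosed.measurableSet, smul_eq_mul] at hX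
    have hv : (muS a).real Q * (R ^ (-(κ * q)) * (C₁ + C₂)) ≤ (C₁ + C₂) * Cv := by
      have e : R ^ (θ + κ) * R ^ (-(κ * q)) = 1 := by
        rw [hθ, ← Real.rpow_add hR0, add_neg_cancel, Real.rpow_zero]
      calc _ ≤ Cv * R ^ (θ + κ) * (R ^ (-(κ * q)) * (C₁ + C₂)) := by
            have := hvol R hR1
            gcongr
        _ = Cv * (R ^ (θ + κ) * R ^ (-(κ * q))) * (C₁ + C₂) := by ring
        _ = _ := by
            rw [e]
            ring
    linarith
  · have e1 := hu.nonneg z hz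
    have e2 := hφ0 z
    have e3 : 0 ≤ Q.indicator (fun _ => R ^ (-(κ * q)) * (C₁ + C₂)) z :=
      Set.indicator_nonneg (fun _ _ => by positivity) z
    positivity
  · have hv := hu.nonneg z (hQS hzQ)
    have hs : 0 ≤ R ^ κ * u z := by positivity
    have hRq : 0 ≤ R ^ (-(κ * q)) := by positivity
    have e : R ^ (-(κ * q)) * (1 / 4 * (φ z ^ (n : ℝ) * (R ^ κ * u z) ^ q)) =
        1 / 4 * (φ z ^ n * u z ^ q) := by
      rw [Real.mul_rpow (by positivity) hv, ← Real.rpow_mul hR0.le, Real.rpow_neg hR0.le,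
        Real.rpow_natCast]
      have : R ^ (κ * q) ≠ 0 := by positivity
      field_simp
    have b1 := mul_le_mul_of_nonneg_left (h₁ (φ z) (R ^ κ * u z) hφz (hφ1 z) hs) hRq
    have b2 := mul_le_mul_of_nonneg_left (h₂ (φ z) (R ^ κ * u z) hφz (hφ1 z) hs) hRq
    rw [mul_add, e] at b1 b2
    have f1 : 0 ≤ R ^ (-(κ * q)) * C₁ := by positivity
    have f2 : 0 ≤ R ^ (-(κ * q)) * C₂ := by positivity
    rw [Set.indicator_of_mem hzQ, mul_add, one_mul]
    refine ⟨by linarith, ?_⟩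
    have b3 : R ^ (-(κ * q)) * (c * φ z ^ (n - 1 : ℝ) * (R ^ κ * u z)) ≤
        R ^ (-(κ * q)) * (c * φ z ^ (n - 1 : ℝ) * (1 + R ^ κ * u z) ^ (1 : ℝ)) := by
      rw [Real.rpow_one]
      gcongr
      linarith
    linarith

lemma IsWeakSol.integral_rpow_le (hp : 1 < p) (hq : 1 < q) (hκ : κ * q = p + κ * (p - 1))
    (hθ : κ * q = θ + κ) (hθ0 : 0 < θ) (hNκ : (N : ℝ) ≤ κ) (hd0 : 0 < d) (hd1 : d < 1)
    (hdq : (d + 1) * (p - 1) < q) (haLip : LocallyLipschitz a) (ha0 : ∀ x, 0 ≤ a x)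
    (haBdd : ∃ Ca, ∀ x, a x ≤ Ca)
    (hu : IsWeakSol N p 1 q (fun _ => 1) (fun _ => 1) a u gu ut) :
    ∃ Cv : ℝ, 0 ≤ Cv ∧ ∀ ε : ℝ, 0 < ε → ∫ z, u z ^ q ∂(muS a) ≤ Cv * ε := by
  have haC := haLip.continuous
  have hq0 : 0 < q := by linarith
  have := isLocallyFiniteMeasure_muS haC
  have hint := hu.integrable_rpow hp hq hκ hθ hθ0 hNκ hd0 hd1 hdq haLip ha0 haBdd
  obtain ⟨Ca, hCa⟩ := haBdd
  obtain ⟨n, hn⟩ := exists_nat_ge (2 + p)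
  have hr : 0 < (d + 1) * (p - 1) := mul_pos (by linarith) (by linarith)
  have hn3 : 2 ≤ n := by
    have : (2 : ℝ) ≤ n := by linarith
    exact_mod_cast this
  obtain ⟨c, hc, henergy⟩ := hu.exists_energy_estimate hp hq0 hκ hθ hd0 hd1 haLip ha0 hn3
  obtain ⟨Cv, hCv, hvol⟩ := exists_muS_real_parabolicCylinder_le (θ := θ) hCa hNκ
  refine ⟨2 * Cv, by positivity, fun ε hε => ?_⟩
  obtain ⟨K, M₁, hK, hM₁, h₁⟩ := exists_scale_mul_one_add_rpow_le hc hε hd0 hp hr hdq.le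
  obtain ⟨M₂, hM₂, h₂⟩ := exists_mul_rpow_le_add_mul (q := q) hc hε one_pos hq.le
  set G : ℕ → Set (Euc N × ℝ) := fun k =>
    parabolicCylinder N (k + 1 : ℝ) (2 / (k + 1 : ℝ)) ((k + 1 : ℝ) ^ θ) with hG
  have hcov : AECover (muS a) Filter.atTop G := aecover_parabolicCylinder haC hθ0
  have htend := hcov.integral_tendsto_of_countably_generated hint
  have key : ∀ k : ℕ, ∫ z in G k, u z ^ q ∂(muS a) ≤ 2 * (ε * Cv + (M₁ + M₂) *
      (∫ z, u z ^ q ∂(muS a) - ∫ z in G k, u z ^ q ∂(muS a))) := fun k => by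
    set R : ℝ := k + 1 with hR
    have hR1 : 1 ≤ R := by simp [hR]
    have hR0 : 0 < R := by linarith
    obtain ⟨φ, hφ, hφ0, hφ1, hφG, hφQ, hφe⟩ := henergy R hR0
    have hGk : G k = parabolicCylinder N R (2 / R) (R ^ θ) := rfl
    rw [← hGk] at hφG hφe
    have hGm : MeasurableSet (G k) := hcov.measurableSet k
    set Q := parabolicCylinder N (2 * R) (1 / R) (2 * R ^ θ) with hQdef
    have hQ : IsCompact Q := isCompact_parabolicCylinder N _ _ _
    have hQS : Q ⊆ Sset N := parabolicCylinder_subset_Sset N _ _ (by positivity)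
    obtain ⟨-, hGle⟩ := hu.setIntegral_rpow_le haC hq0 hQ hQS
      (isCompact_parabolicCylinder N _ _ _) hφ hφ0
      hφG hφQ (n := n) (by omega)
    rw [← hGk] at hGle
    have hiQ : Integrable (Q.indicator fun _ => R ^ (-(κ * q)) * ε) (muS a) :=
      (integrable_indicator_iff hQ.isClosed.measurableSet).2
        (integrableOn_const hQ.measure_lt_top.ne)
    have hiG : Integrable ((G k)ᶜ.indicator fun z => (M₁ + M₂) * u z ^ q) (muS a) :=
      (hint.const_mul _).indicator hGm.compl
    have hX := hφe K hK (fun z => Q.indicator (fun _ => R ^ (-(κ * q)) * ε) z +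
      (G k)ᶜ.indicator (fun z => (M₁ + M₂) * u z ^ q) z) (hiQ.add hiG)
      (fun z hz => ?_) fun z hzQ hzG hφz => ?_
    · rw [integral_add hiQ hiG, integral_indicator_const _ hQ.isClosed.measurableSet, smul_eq_mul,
        integral_indicator hGm.compl, integral_const_mul,
        setIntegral_compl hGm hint] at hX
      have hv : (muS a).real Q * (R ^ (-(κ * q)) * ε) ≤ ε * Cv := by
        have e : R ^ (θ + κ) * R ^ (-(κ * q)) = 1 := by
          rw [hθ, ← Real.rpow_add hR0, add_neg_cancel, Real.rpow_zero]
        calc _ ≤ Cv * R ^ (θ + κ) * (R ^ (-(κ * q)) * ε) := by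
              have := hvol R hR1
              gcongr
          _ = Cv * (R ^ (θ + κ) * R ^ (-(κ * q))) * ε := by ring
          _ = _ := by
              rw [e]
              ring
      linarith
    · refine add_nonneg (Set.indicator_nonneg (fun _ _ => by positivity) z)
        (Set.indicator_apply_nonneg fun _ => ?_)
      have := hu.nonneg z hz
      positivity
    · have hv := hu.nonneg z (hQS hzQ)
      have hs : 0 ≤ R ^ κ * u z := by positivity
      have hRq : 0 ≤ R ^ (-(κ * q)) := by positivity
      have e : ∀ M : ℝ, R ^ (-(κ * q)) * (ε + M * (R ^ κ * u z) ^ q) =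
          R ^ (-(κ * q)) * ε + M * u z ^ q := fun M => by
        rw [Real.mul_rpow (by positivity) hv, ← Real.rpow_mul hR0.le, Real.rpow_neg hR0.le]
        have : R ^ (κ * q) ≠ 0 := by positivity
        field_simp
      have b1 := mul_le_mul_of_nonneg_left (h₁ (R ^ κ * u z) hs) hRq
      have b2 := mul_le_mul_of_nonneg_left (h₂ (R ^ κ * u z) hs) hRq
      rw [e] at b1 b2
      rw [Real.rpow_one] at b2
      have f1 : 0 ≤ M₁ * u z ^ q := by positivity
      have f2 : 0 ≤ M₂ * u z ^ q := by positivity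
      have g1 : φ z ^ (n - p) ≤ 1 := Real.rpow_le_one hφz.le (hφ1 z) (by linarith)
      have g2 : φ z ^ (n - 1 : ℝ) ≤ 1 := Real.rpow_le_one hφz.le (hφ1 z) (by linarith)
      have c1 : R ^ (-(κ * q)) * (c * (d * K) ^ (1 - p) * φ z ^ (n - p) *
          (1 + K * (R ^ κ * u z)) ^ ((d + 1) * (p - 1))) ≤
          R ^ (-(κ * q)) * (c * (d * K) ^ (1 - p) * 1 *
          (1 + K * (R ^ κ * u z)) ^ ((d + 1) * (p - 1))) := by gcongr
      have c2 : R ^ (-(κ * q)) * (c * φ z ^ (n - 1 : ℝ) * (R ^ κ * u z)) ≤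
          R ^ (-(κ * q)) * (c * 1 * (R ^ κ * u z)) := by gcongr
      rw [mul_one] at c1 c2
      rw [Set.indicator_of_mem hzQ, Set.indicator_of_mem (by exact hzG), add_mul M₁]
      constructor <;> linarith
  have hlim := le_of_tendsto_of_tendsto' htend
    (((htend.const_sub (∫ z, u z ^ q ∂(muS a))).const_mul (M₁ + M₂)).const_add
      (ε * Cv) |>.const_mul 2) key
  rw [sub_self, mul_zero, add_zero] at hlim
  linarith

end Liouville

/-- Evolution p-Laplacian (I2), Euclidean case: nonexistence for
`∂ₜ u ≥ Δ_p u + u^q` (here `m = 1`, `f ≡ 1`). -/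
theorem pLaplacian_nonexistence
    (N : ℕ) (hN : 1 ≤ N) (p q : ℝ) (hp : 1 < p)
    (a : Euc N → ℝ)
    (haLip : LocallyLipschitz a)
    (haPos : ∀ᵐ x ∂ (volume : Measure (Euc N)), 0 < a x)
    (haBdd : ∃ Ca : ℝ, ∀ x, |a x| ≤ Ca)
    (hq1 : max 1 (p - 1) < q) (hq2 : q ≤ p / (N : ℝ) + p - 1)
    (u : Euc N × ℝ → ℝ) (gu : Euc N × ℝ → Euc N) (ut : Euc N × ℝ → ℝ)
    (hu : IsWeakSol N p 1 q (fun _ => 1) (fun _ => 1) a u gu ut) :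
    (∀ᵐ z ∂ ((volume : Measure (Euc N × ℝ)).restrict (Sset N)), u z = 0) ∧
      p > 2 * (N : ℝ) / ((N : ℝ) + 1) := by
  have hq : 1 < q := (le_max_left _ _).trans_lt hq1
  have hqp : 0 < q - p + 1 := by
    have := (le_max_right 1 (p - 1)).trans_lt hq1
    linarith
  have hN0 : (0 : ℝ) < N := by exact_mod_cast hN
  have hqN : (q - p + 1) * N ≤ p := by
    rw [← le_div_iff₀ hN0]
    linarith
  refine ⟨?_, ?_⟩
  · have haC := haLip.continuous
    have ha0 : ∀ x, 0 ≤ a x := fun x => by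
      have hcl : IsClosed {x | 0 ≤ a x} := isClosed_le continuous_const haC
      have hd : Dense {x | 0 ≤ a x} :=
        Measure.dense_of_ae (μ := volume) (haPos.mono fun x hx => hx.le)
      have : x ∈ closure {x | 0 ≤ a x} := hd x
      rwa [hcl.closure_eq] at this
    have haB : ∃ Ca, ∀ x, a x ≤ Ca := haBdd.imp fun Ca h x => (le_abs_self _).trans (h x)
    set κ : ℝ := p / (q - p + 1) with hκdef
    have hκ0 : 0 < κ := by positivity
    have hκ : κ * (q - p + 1) = p := div_mul_cancel₀ _ hqp.ne'
    have hNκ : (N : ℝ) ≤ κ := by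
      rw [hκdef, le_div_iff₀ hqp]
      linarith
    obtain ⟨d, hd0, hd1, hdq⟩ : ∃ d : ℝ, 0 < d ∧ d < 1 ∧ (d + 1) * (p - 1) < q := by
      refine ⟨min (1 / 2) ((q - p + 1) / (2 * (p - 1))), lt_min (by norm_num)
        (div_pos hqp (by linarith)), (min_le_left _ _).trans_lt (by norm_num), ?_⟩
      have := min_le_right (1 / 2) ((q - p + 1) / (2 * (p - 1)))
      rw [le_div_iff₀ (by linarith)] at this
      linarith
    have hθ0 : 0 < κ * (q - 1) := mul_pos hκ0 (by linarith)
    have hint := hu.integrable_rpow (θ := κ * (q - 1)) hp hq (by linarith) (by ring) hθ0 hNκ hd0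
      hd1 hdq haLip ha0 haB
    obtain ⟨Cv, hCv, hle⟩ := hu.integral_rpow_le (θ := κ * (q - 1)) hp hq (by linarith) (by ring)
      hθ0 hNκ hd0 hd1 hdq haLip ha0 haB
    have hnn : 0 ≤ᵐ[muS a] fun z => u z ^ q := by
      filter_upwards [ae_muS_mem_Sset haC] with z hz
      exact Real.rpow_nonneg (hu.nonneg z hz) q
    have hI : ∫ z, u z ^ q ∂(muS a) = 0 := by
      refine le_antisymm (le_of_forall_pos_le_add fun η hη => ?_) (integral_nonneg_of_ae hnn)
      refine (hle (η / (Cv + 1)) (by positivity)).trans ?_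
      rw [zero_add, mul_div_assoc', div_le_iff₀ (by positivity)]
      nlinarith
    rw [integral_eq_zero_iff_of_nonneg_ae hnn hint] at hI
    filter_upwards [ae_restrict_of_ae_muS haC haPos hI,
      ae_restrict_mem (isOpen_Sset N).measurableSet] with z hz hzS
    exact (Real.rpow_eq_zero (hu.nonneg z hzS) (by linarith)).1 hz
  · rw [gt_iff_lt, div_lt_iff₀ (by positivity)]
    nlinarith

end
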